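/- arXiv:0902.0708 — 2 statements merged into one kernel-verified Lean document; each statement's English description precedes it below -/
import Mathlib

section
/- For real numbers h > 0, μ, ν, δ with δ > −1, μ + δ > −1, ν + δ > −1, μ + ν + δ > −1, the integral ∫_0^∞ r^{μ+ν+δ+1} J_δ(hr) K_μ(r) K_ν(r) dr converges and equals 2^{μ+ν+δ-1} h^δ · Γ(μ+δ+1)Γ(ν+δ+1)Γ(μ+ν+δ+1)/Γ(μ+ν+2δ+2) · ₃F₂(μ+δ+1, ν+δ+1, μ+ν+δ+1; (μ+ν)/2+δ+1, (μ+ν)/2+δ+3/2; −h²/4). -/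
open MeasureTheory

/-- The Pochhammer (rising factorial) symbol `(a)_k`. -/
noncomputable def poch (a : ℝ) (k : ℕ) : ℝ := ∏ i ∈ Finset.range k, (a + i)

/-- Bessel function of the first kind `J_δ`, via its power series. -/
noncomputable def besselJ (δ : ℝ) (w : ℝ) : ℝ :=
  ∑' k : ℕ, (-1) ^ k / (k.factorial * Real.Gamma (δ + 1 + k)) * (w / 2) ^ (δ + 2 * k)

/-- Modified Bessel function of the second kind (Macdonald function) `K_μ`, via its
standard integral representation (valid for `r > 0`). -/
noncomputable def besselK (μ : ℝ) (r : ℝ) : ℝ :=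
  ∫ t in Set.Ioi (0:ℝ), Real.exp (-r * Real.cosh t) * Real.cosh (μ * t)

/-- The everywhere-convergent generalized hypergeometric series `₂F₂`. -/
noncomputable def hyp2F2 (a b c e w : ℝ) : ℝ :=
  ∑' k : ℕ, poch a k * poch b k / (poch c k * poch e k * k.factorial) * w ^ k

/-- `₃F₂(a₁,a₂,a₃;b₁,b₂;w)` via the Laplace-type integral representation
(valid for `a₁ > 0` and `w < 1`, and agreeing with the defining series for `|w| < 1`). -/
noncomputable def hyp3F2 (a₁ a₂ a₃ b₁ b₂ w : ℝ) : ℝ :=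
  (1 / Real.Gamma a₁) *
    ∫ t in Set.Ioi (0:ℝ), Real.exp (-t) * t ^ (a₁ - 1) * hyp2F2 a₂ a₃ b₁ b₂ (w * t)

lemma integrableOn_rpow_mul_exp_neg {a p : ℝ} (ha : 0 < a) (hp : 0 < p) :
    IntegrableOn (fun t : ℝ => t ^ (a - 1) * Real.exp (-(p * t))) (Set.Ioi 0) := by
  have := integrableOn_rpow_mul_exp_neg_mul_rpow (p := 1) (s := a - 1) (b := p)
    (by linarith) one_pos hp
  simpa [neg_mul] using this

lemma integral_rpow_mul_exp_neg {a p : ℝ} (ha : 0 < a) (hp : 0 < p) :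
    ∫ t in Set.Ioi (0:ℝ), t ^ (a - 1) * Real.exp (-(p * t)) = Real.Gamma a * p ^ (-a) := by
  rw [Real.integral_rpow_mul_exp_neg_mul_Ioi ha hp, mul_comm, one_div, Real.inv_rpow hp.le,
    Real.rpow_neg hp.le]

lemma integrableOn_rpow_mul_exp_neg_sq {a p : ℝ} (ha : 0 < a) (hp : 0 < p) :
    IntegrableOn (fun r : ℝ => r ^ (2 * a - 1) * Real.exp (-(p * r ^ 2))) (Set.Ioi 0) := by
  have := integrableOn_rpow_mul_exp_neg_mul_rpow (p := 2) (s := 2 * a - 1) (b := p)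
    (by linarith) two_pos hp
  simpa [neg_mul] using this

lemma integral_rpow_mul_exp_neg_sq {a p : ℝ} (ha : 0 < a) (hp : 0 < p) :
    ∫ r in Set.Ioi (0:ℝ), r ^ (2 * a - 1) * Real.exp (-(p * r ^ 2))
      = Real.Gamma a / 2 * p ^ (-a) := by
  have := integral_rpow_mul_exp_neg_mul_rpow (p := 2) (q := 2 * a - 1) (b := p)
    two_pos (by linarith) hp
  have e1 : -(2 * a - 1 + 1) / 2 = -a := by ring
  have e2 : (2 * a - 1 + 1) / 2 = a := by ring
  simp only [e1, e2, neg_mul, Real.rpow_two] at this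
  rw [this]; ring

/-- Tonelli's theorem for a nonnegative function with a known partial integral. -/
lemma integrable_prod_of_integral_left {α : Type*} [MeasurableSpace α] {m : Measure α}
    [SFinite m] {f : ℝ × α → ℝ} {g : α → ℝ} (hf : Measurable f)
    (hpos : ∀ᵐ y ∂m, ∀ x ∈ Set.Ioi (0:ℝ), 0 ≤ f (x, y))
    (hint : ∀ᵐ y ∂m, IntegrableOn (fun x => f (x, y)) (Set.Ioi 0))
    (hval : ∀ᵐ y ∂m, ∫ x in Set.Ioi (0:ℝ), f (x, y) = g y) (hg : Integrable g m) :
    Integrable f ((volume.restrict (Set.Ioi 0)).prod m) := by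
  rw [integrable_prod_iff' hf.aestronglyMeasurable]
  refine ⟨hint, hg.congr ?_⟩
  filter_upwards [hpos, hval] with y h1 h2
  rw [← h2]
  refine setIntegral_congr_fun measurableSet_Ioi fun x hx => ?_
  simp only [Real.norm_eq_abs, abs_of_nonneg (h1 x hx)]

lemma poch_succ (a : ℝ) (k : ℕ) : poch a (k + 1) = poch a k * (a + k) := by
  simp [poch, Finset.prod_range_succ]

lemma poch_zero (a : ℝ) : poch a 0 = 1 := by simp [poch]

lemma poch_pos {a : ℝ} (ha : 0 < a) (k : ℕ) : 0 < poch a k :=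
  Finset.prod_pos fun i _ => by positivity

lemma Gamma_add_nat {a : ℝ} (ha : 0 < a) (k : ℕ) :
    Real.Gamma (a + k) = Real.Gamma a * poch a k := by
  induction k with
  | zero => simp [poch_zero]
  | succ k ih =>
    have : a + ((k + 1 : ℕ) : ℝ) = (a + k) + 1 := by push_cast; ring
    rw [this, Real.Gamma_add_one (by positivity), ih, poch_succ]; ring

lemma poch_two_mul (b : ℝ) (k : ℕ) :
    poch (2 * b) (2 * k) = 4 ^ k * poch b k * poch (b + 1 / 2) k := by
  induction k with
  | zero => simp [poch_zero]
  | succ k ih =>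
    rw [show 2 * (k + 1) = 2 * k + 1 + 1 by ring, poch_succ, poch_succ, ih, poch_succ, poch_succ]
    push_cast; ring

lemma pow_le_poch {a : ℝ} (ha : 0 < a) (k : ℕ) : a ^ k ≤ poch a k := by
  induction k with
  | zero => simp [poch_zero]
  | succ k ih =>
    rw [poch_succ, pow_succ]
    have : (0:ℝ) ≤ k := by positivity
    exact mul_le_mul ih (by linarith) ha.le (poch_pos ha k).le

lemma poch_div_le {a b : ℝ} (ha : 0 < a) (hb : 0 < b) (k : ℕ) :
    poch a k / poch b k ≤ (1 + a / b) ^ k := by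
  induction k with
  | zero => simp [poch_zero]
  | succ k ih =>
    rw [poch_succ, poch_succ, mul_div_mul_comm, pow_succ]
    have h0 := poch_pos ha k
    have h1 := poch_pos hb k
    refine mul_le_mul ih ?_ (by positivity) (by positivity)
    rw [div_le_iff₀ (by positivity)]
    have : (1 + a / b) * (b + k) = b + a + k + a / b * k := by field_simp; ring
    rw [this]
    have : 0 ≤ a / b * k := by positivity
    linarith

lemma summable_poch_ratio {a b c e : ℝ} (ha : 0 < a) (hb : 0 < b) (hc : 0 < c) (he : 0 < e)
    {x : ℝ} (hx : 0 ≤ x) :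
    Summable fun k : ℕ => poch a k * poch b k / (poch c k * poch e k * k.factorial) * x ^ k := by
  refine Summable.of_nonneg_of_le (fun k => ?_) (fun k => ?_)
    (Real.summable_pow_div_factorial ((1 + a / c) * (1 + b / e) * x))
  · have := poch_pos ha k; have := poch_pos hb k
    have := poch_pos hc k; have := poch_pos he k
    positivity
  · have h1 := poch_pos ha k; have h2 := poch_pos hb k
    have h3 := poch_pos hc k; have h4 := poch_pos he k
    have : poch a k * poch b k / (poch c k * poch e k * k.factorial) * x ^ k
        = (poch a k / poch c k) * (poch b k / poch e k) * x ^ k / k.factorial := by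
      field_simp
    rw [this, mul_pow, mul_pow]
    gcongr
    · exact poch_div_le ha hc k
    · exact poch_div_le hb he k

/-- The confluent limit function `₀F₁(; a; -z)`. -/
noncomputable def hyp0F1Neg (a z : ℝ) : ℝ := ∑' k : ℕ, (-z) ^ k / (k.factorial * poch a k)

lemma summable_hyp0F1Neg {a : ℝ} (ha : 0 < a) (z : ℝ) :
    Summable fun k : ℕ => (-z) ^ k / (k.factorial * poch a k) := by
  refine Summable.of_norm_bounded (Real.summable_pow_div_factorial (|z| / a)) fun k => ?_
  have h1 := poch_pos ha k
  have h2 := pow_le_poch ha k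
  rw [norm_div, norm_pow, norm_neg, Real.norm_eq_abs, Real.norm_eq_abs,
    abs_of_pos (by positivity : 0 < (k.factorial : ℝ) * poch a k), div_pow, div_div, mul_comm]
  gcongr

lemma measurable_hyp0F1Neg {a : ℝ} (ha : 0 < a) : Measurable (hyp0F1Neg a) := by
  refine measurable_of_tendsto_metrizable
    (f := fun n z => ∑ k ∈ Finset.range n, (-z) ^ k / (k.factorial * poch a k))
    (fun n => by fun_prop) ?_
  rw [tendsto_pi_nhds]
  exact fun z => (summable_hyp0F1Neg ha z).hasSum.tendsto_sum_nat

lemma hyp0F1Neg_recurrence {a : ℝ} (ha : 0 < a) (z : ℝ) :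
    hyp0F1Neg a z = hyp0F1Neg (a + 1) z - z / (a * (a + 1)) * hyp0F1Neg (a + 2) z := by
  have shift : ∀ (b : ℝ) (k : ℕ), poch b (k + 1) = b * poch (b + 1) k := by
    intro b k
    rw [poch, Finset.prod_range_succ', poch]
    simp only [Nat.cast_zero, add_zero]
    rw [mul_comm]
    congr 1
    exact Finset.prod_congr rfl fun i _ => by push_cast; ring
  have ha1 : 0 < a + 1 := by linarith
  have ha2 : 0 < a + 2 := by linarith
  unfold hyp0F1Neg
  have s0 := summable_hyp0F1Neg ha z
  have s1 := summable_hyp0F1Neg ha1 z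
  rw [s0.tsum_eq_zero_add, s1.tsum_eq_zero_add, ← tsum_mul_left, add_sub_assoc,
    ← ((summable_nat_add_iff 1).2 s1).tsum_sub ((summable_hyp0F1Neg ha2 z).mul_left _)]
  simp only [poch_zero, pow_zero]
  congr 1
  refine tsum_congr fun k => ?_
  have e2 : a + 1 + 1 = a + 2 := by ring
  have h2 := poch_pos ha2 k
  have h3 : (a + 1) * poch (a + 2) k = poch (a + 1) k * (a + 1 + k) := by
    rw [← e2, ← shift, poch_succ]
  have h1 := poch_pos ha1 k
  have h4 : poch (a + 2) k = poch (a + 1) k * (a + 1 + k) / (a + 1) := by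
    field_simp; linarith
  rw [shift a, poch_succ (a + 1), Nat.factorial_succ, h4]
  push_cast
  have : (0:ℝ) < a + 1 + k := by positivity
  field_simp
  ring

lemma integrable_beta {a b : ℝ} (ha : 0 < a) (hb : 0 < b) :
    IntegrableOn (fun z : ℝ => z ^ (a - 1) * (1 + z) ^ (-(a + b))) (Set.Ioi 0) ∧
    ∫ z in Set.Ioi (0:ℝ), z ^ (a - 1) * (1 + z) ^ (-(a + b))
      = Real.Gamma a * Real.Gamma b / Real.Gamma (a + b) := by
  have hab : 0 < a + b := by linarith
  set f : ℝ × ℝ → ℝ := fun q =>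
    q.1 ^ (a - 1) * (q.2 ^ (a + b - 1) * Real.exp (-((1 + q.1) * q.2))) with hf
  have hrew : ∀ t ∈ Set.Ioi (0:ℝ), ∀ z : ℝ, f (z, t) =
      t ^ (a + b - 1) * Real.exp (-(1 * t)) * (z ^ (a - 1) * Real.exp (-(t * z))) := by
    intro t ht z
    have : Real.exp (-((1 + z) * t)) = Real.exp (-(1 * t)) * Real.exp (-(t * z)) := by
      rw [← Real.exp_add]; congr 1; ring
    simp only [hf, this]; ring
  have hin : ∀ t ∈ Set.Ioi (0:ℝ), ∫ z in Set.Ioi (0:ℝ), f (z, t)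
      = Real.Gamma a * (t ^ (b - 1) * Real.exp (-(1 * t))) := by
    intro t ht
    have ht' : (0:ℝ) < t := ht
    simp only [hrew t ht]
    rw [integral_const_mul, integral_rpow_mul_exp_neg ha ht,
      show b - 1 = (a + b - 1) + -a by ring, Real.rpow_add ht']
    ring
  have hI : Integrable f ((volume.restrict (Set.Ioi 0)).prod (volume.restrict (Set.Ioi 0))) := by
    refine integrable_prod_of_integral_left (by fun_prop) ?_ ?_
      ((ae_restrict_mem measurableSet_Ioi).mono hin)
      ((integrableOn_rpow_mul_exp_neg hb one_pos).const_mul _)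
    · filter_upwards [ae_restrict_mem measurableSet_Ioi] with t ht z hz
      have ht' : (0:ℝ) < t := ht
      have hz' : (0:ℝ) < z := hz
      positivity
    · filter_upwards [ae_restrict_mem measurableSet_Ioi] with t ht
      simp only [hrew t ht]
      exact (integrableOn_rpow_mul_exp_neg ha ht).const_mul _
  have hout : ∀ z ∈ Set.Ioi (0:ℝ), ∫ t in Set.Ioi (0:ℝ), f (z, t)
      = Real.Gamma (a + b) * (z ^ (a - 1) * (1 + z) ^ (-(a + b))) := by
    intro z hz
    have hz' : (0:ℝ) < z := hz
    simp only [hf]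
    rw [integral_const_mul, integral_rpow_mul_exp_neg hab (by positivity)]
    ring
  have hG := Real.Gamma_pos_of_pos hab
  have hI2 : IntegrableOn (fun z => Real.Gamma (a + b) * (z ^ (a - 1) * (1 + z) ^ (-(a + b))))
      (Set.Ioi 0) :=
    hI.integral_prod_left.congr ((ae_restrict_mem measurableSet_Ioi).mono hout)
  constructor
  · refine (hI2.const_mul (Real.Gamma (a + b))⁻¹).congr (Filter.Eventually.of_forall fun z => ?_)
    simp only
    rw [inv_mul_cancel_left₀ hG.ne']
  · have := integral_integral_swap (f := fun z t => f (z, t)) hI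
    rw [setIntegral_congr_fun measurableSet_Ioi hout, setIntegral_congr_fun measurableSet_Ioi hin,
      integral_const_mul, integral_const_mul, integral_rpow_mul_exp_neg hb one_pos] at this
    rw [eq_div_iff hG.ne', mul_comm, this]
    simp

lemma poch_one (k : ℕ) : poch 1 k = k.factorial := by
  have := Gamma_add_nat one_pos k
  rw [Real.Gamma_one, one_mul, add_comm, Real.Gamma_nat_eq_factorial] at this
  exact this.symm

lemma hyp0F1Neg_half {z : ℝ} (hz : 0 ≤ z) : hyp0F1Neg (1 / 2) z = Real.cos (2 * √z) := by
  rw [← (Real.hasSum_cos (2 * √z)).tsum_eq, hyp0F1Neg]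
  refine tsum_congr fun k => ?_
  have h1 := poch_two_mul (1 / 2) k
  rw [show (2:ℝ) * (1 / 2) = 1 by norm_num, show (1:ℝ) / 2 + 1 / 2 = 1 by norm_num, poch_one,
    poch_one] at h1
  have h2 := poch_pos (a := 1 / 2) (by norm_num) k
  rw [h1, pow_mul, mul_pow, Real.sq_sqrt hz, neg_pow]
  field_simp
  norm_num [mul_pow]
  ring

/-- Termwise integration of a `₀F₁` series against a nonnegative density with known moments. -/
lemma integral_mul_hyp0F1Neg {α : Type*} [MeasurableSpace α] {m : Measure α} {w g : α → ℝ}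
    {M : ℕ → ℝ} {a : ℝ} (ha : 0 < a) (x : ℝ) (hw : ∀ᵐ q ∂m, 0 ≤ w q) (hg : ∀ᵐ q ∂m, 0 ≤ g q)
    (hI : ∀ k, Integrable (fun q => w q * g q ^ k) m) (hM : ∀ k, ∫ q, w q * g q ^ k ∂m = M k)
    (hs : Summable fun k : ℕ => |x| ^ k / (k.factorial * poch a k) * M k) :
    ∫ q, w q * hyp0F1Neg a (x * g q) ∂m
      = ∑' k : ℕ, (-x) ^ k / (k.factorial * poch a k) * M k := by
  have key := hasSum_integral_of_summable_integral_norm (μ := m)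
    (F := fun (k : ℕ) q => (-x) ^ k / (k.factorial * poch a k) * (w q * g q ^ k))
    (fun k => (hI k).const_mul _) ?_
  · have hL : ∫ q, w q * hyp0F1Neg a (x * g q) ∂m
        = ∫ q, ∑' k : ℕ, (-x) ^ k / (k.factorial * poch a k) * (w q * g q ^ k) ∂m := by
      congr 1; ext q
      rw [hyp0F1Neg, ← tsum_mul_left]
      refine tsum_congr fun k => ?_
      rw [← neg_mul x, mul_pow]; ring
    rw [hL, ← key.tsum_eq]
    exact tsum_congr fun k => by rw [integral_const_mul, hM]
  · refine hs.congr fun k => ?_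
    have h2 := poch_pos ha k
    rw [integral_congr_ae (g := fun q => |x| ^ k / (k.factorial * poch a k) * (w q * g q ^ k)),
      integral_const_mul, hM]
    filter_upwards [hw, hg] with q h3 h4
    rw [norm_mul, Real.norm_of_nonneg (by positivity : 0 ≤ w q * g q ^ k), norm_div, norm_pow,
      norm_neg, Real.norm_of_nonneg (by positivity : 0 ≤ (k.factorial : ℝ) * poch a k),
      Real.norm_eq_abs]

/-- Integrating a `₀F₁` series against a density raises its parameter. -/
lemma hyp0F1Neg_eq_integral {a b : ℝ} (ha : 0 < a) (hb : 0 < b) (x : ℝ) :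
    ∫ z in Set.Ioi (0:ℝ), z ^ (a - 1) * (1 + z) ^ (-(a + b)) * hyp0F1Neg a (x * (z / (1 + z)))
      = Real.Gamma a * Real.Gamma b / Real.Gamma (a + b) * hyp0F1Neg (a + b) x := by
  have hab : 0 < a + b := by linarith
  have hW : ∀ k : ℕ, ∀ z ∈ Set.Ioi (0:ℝ),
      z ^ (a - 1) * (1 + z) ^ (-(a + b)) * (z / (1 + z)) ^ k
        = z ^ (a + k - 1) * (1 + z) ^ (-((a + k) + b)) := by
    intro k z hz
    have hz' : (0:ℝ) < z := hz
    have hz1 : 0 < 1 + z := by linarith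
    rw [show a + k - 1 = (a - 1) + k by ring, show -((a + k) + b) = -(a + b) + -(k:ℝ) by ring,
      Real.rpow_add hz', Real.rpow_add hz1, Real.rpow_neg hz1.le (k:ℝ), Real.rpow_natCast,
      Real.rpow_natCast, div_pow]
    ring
  have hI : ∀ k : ℕ, IntegrableOn
      (fun z : ℝ => z ^ (a - 1) * (1 + z) ^ (-(a + b)) * (z / (1 + z)) ^ k) (Set.Ioi 0) := fun k =>
    (integrableOn_congr_fun (hW k) measurableSet_Ioi).2
      (integrable_beta (a := a + k) (by positivity) hb).1
  have hV : ∀ k : ℕ, ∫ z in Set.Ioi (0:ℝ),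
      z ^ (a - 1) * (1 + z) ^ (-(a + b)) * (z / (1 + z)) ^ k
        = Real.Gamma a * Real.Gamma b / Real.Gamma (a + b) * (poch a k / poch (a + b) k) := by
    intro k
    rw [setIntegral_congr_fun measurableSet_Ioi (hW k),
      (integrable_beta (a := a + k) (by positivity) hb).2,
      show a + k + b = (a + b) + k by ring, Gamma_add_nat ha, Gamma_add_nat hab]
    have h1 := poch_pos hab k
    have h2 := Real.Gamma_pos_of_pos hab
    field_simp
  have hco : ∀ (y : ℝ) (k : ℕ), y ^ k / (k.factorial * poch a k) *
      (Real.Gamma a * Real.Gamma b / Real.Gamma (a + b) * (poch a k / poch (a + b) k))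
      = Real.Gamma a * Real.Gamma b / Real.Gamma (a + b) *
        (y ^ k / (k.factorial * poch (a + b) k)) := by
    intro y k
    have h1 := poch_pos hab k
    have h2 := poch_pos ha k
    field_simp
  rw [integral_mul_hyp0F1Neg (w := fun z => z ^ (a - 1) * (1 + z) ^ (-(a + b)))
    (g := fun z => z / (1 + z)) ha x ?_ ?_ hI hV ?_]
  · simp only [hco]
    rw [tsum_mul_left, hyp0F1Neg]
  · filter_upwards [ae_restrict_mem measurableSet_Ioi] with z (hz : (0:ℝ) < z)
    positivity
  · filter_upwards [ae_restrict_mem measurableSet_Ioi] with z (hz : (0:ℝ) < z)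
    positivity
  · simp only [hco]
    have := summable_hyp0F1Neg hab (-|x|)
    rw [neg_neg] at this
    exact this.mul_left _

lemma abs_hyp0F1Neg_le_one {a z : ℝ} (ha : 1 / 2 ≤ a) (hz : 0 ≤ z) : |hyp0F1Neg a z| ≤ 1 := by
  rcases ha.eq_or_lt with rfl | ha
  · rw [hyp0F1Neg_half hz]; exact Real.abs_cos_le_one _
  obtain ⟨b, rfl⟩ : ∃ b, a = 1 / 2 + b := ⟨a - 1 / 2, by ring⟩
  have hb : 0 < b := by linarith
  have h0 : (0:ℝ) < 1 / 2 := by norm_num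
  have h := hyp0F1Neg_eq_integral h0 hb z
  obtain ⟨hi, hv⟩ := integrable_beta h0 hb
  have hB : 0 < Real.Gamma (1 / 2) * Real.Gamma b / Real.Gamma (1 / 2 + b) :=
    div_pos (mul_pos (Real.Gamma_pos_of_pos h0) (Real.Gamma_pos_of_pos hb))
      (Real.Gamma_pos_of_pos (by linarith))
  have hle : ‖∫ y in Set.Ioi (0:ℝ), y ^ ((1:ℝ) / 2 - 1) * (1 + y) ^ (-(1 / 2 + b)) *
      hyp0F1Neg (1 / 2) (z * (y / (1 + y)))‖
      ≤ Real.Gamma (1 / 2) * Real.Gamma b / Real.Gamma (1 / 2 + b) := by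
    rw [← hv]
    refine norm_integral_le_of_norm_le hi ?_
    filter_upwards [ae_restrict_mem measurableSet_Ioi] with y hy
    have hy' : (0:ℝ) < y := hy
    rw [norm_mul, Real.norm_of_nonneg (by positivity), hyp0F1Neg_half (by positivity)]
    exact mul_le_of_le_one_right (by positivity) (Real.abs_cos_le_one _)
  rw [h, norm_mul, Real.norm_of_nonneg hB.le] at hle
  exact le_of_mul_le_mul_left (by simpa using hle) hB

lemma abs_hyp0F1Neg_le {a z : ℝ} (ha : 0 < a) (hz : 0 ≤ z) :
    |hyp0F1Neg a z| ≤ (1 + 1 / (a * (a + 1))) * (1 + z) := by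
  rw [hyp0F1Neg_recurrence ha]
  have h1 := abs_hyp0F1Neg_le_one (a := a + 1) (by linarith) hz
  have h2 := abs_hyp0F1Neg_le_one (a := a + 2) (by linarith) hz
  calc _ ≤ |hyp0F1Neg (a + 1) z| + |z / (a * (a + 1)) * hyp0F1Neg (a + 2) z| := abs_sub _ _
    _ ≤ 1 + z / (a * (a + 1)) * 1 := by
      rw [abs_mul, abs_of_nonneg (by positivity : 0 ≤ z / (a * (a + 1)))]
      gcongr
    _ ≤ _ := by
      have : 0 ≤ 1 / (a * (a + 1)) := by positivity
      have e : z / (a * (a + 1)) = 1 / (a * (a + 1)) * z := by ring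
      rw [e]; nlinarith

/-- The Laplace transform of `t ^ (a - 1) * ₀F₁(; a; -c t)`. -/
lemma integral_rpow_mul_exp_mul_hyp0F1Neg {a p : ℝ} (ha : 0 < a) (hp : 0 < p) (c : ℝ) :
    ∫ t in Set.Ioi (0:ℝ), t ^ (a - 1) * Real.exp (-(p * t)) * hyp0F1Neg a (c * t)
      = Real.Gamma a * p ^ (-a) * Real.exp (-(c / p)) := by
  have hW : ∀ k : ℕ, ∀ t ∈ Set.Ioi (0:ℝ), t ^ (a - 1) * Real.exp (-(p * t)) * t ^ k
        = t ^ (a + k - 1) * Real.exp (-(p * t)) := by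
    intro k t ht
    rw [show a + k - 1 = (a - 1) + k by ring, Real.rpow_add ht, Real.rpow_natCast]
    ring
  have hI : ∀ k : ℕ, IntegrableOn (fun t : ℝ => t ^ (a - 1) * Real.exp (-(p * t)) * t ^ k)
      (Set.Ioi 0) := fun k =>
    (integrableOn_congr_fun (hW k) measurableSet_Ioi).2
      (integrableOn_rpow_mul_exp_neg (a := a + k) (by positivity) hp)
  have hV : ∀ k : ℕ, ∫ t in Set.Ioi (0:ℝ), t ^ (a - 1) * Real.exp (-(p * t)) * t ^ k
        = Real.Gamma a * p ^ (-a) * (poch a k / p ^ k) := by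
    intro k
    rw [setIntegral_congr_fun measurableSet_Ioi (hW k),
      integral_rpow_mul_exp_neg (a := a + k) (by positivity) hp, Gamma_add_nat ha,
      neg_add, Real.rpow_add hp, Real.rpow_neg hp.le k, Real.rpow_natCast]
    ring
  have hco : ∀ (y : ℝ) (k : ℕ), y ^ k / (k.factorial * poch a k) *
      (Real.Gamma a * p ^ (-a) * (poch a k / p ^ k))
      = Real.Gamma a * p ^ (-a) * ((y / p) ^ k / k.factorial) := by
    intro y k
    have h2 := poch_pos ha k
    rw [div_pow]
    field_simp
  have hexp : Real.exp (-(c / p)) = ∑' k : ℕ, (-c / p) ^ k / k.factorial := by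
    rw [Real.exp_eq_exp_ℝ, NormedSpace.exp_eq_tsum_div, neg_div]
  rw [integral_mul_hyp0F1Neg (w := fun t => t ^ (a - 1) * Real.exp (-(p * t)))
    (g := fun t => t) ha c ?_ ?_ hI hV ?_]
  · simp only [hco]
    rw [tsum_mul_left, hexp]
  · filter_upwards [ae_restrict_mem measurableSet_Ioi] with z (hz : (0:ℝ) < z)
    positivity
  · filter_upwards [ae_restrict_mem measurableSet_Ioi] with z (hz : (0:ℝ) < z)
    exact hz.le
  · simp only [hco]
    exact (Real.summable_pow_div_factorial _).mul_left _

lemma integral_rpow_mul_exp_sq_mul_hyp0F1Neg {a p : ℝ} (ha : 0 < a) (hp : 0 < p) (c : ℝ) :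
    ∫ r in Set.Ioi (0:ℝ), r ^ (2 * a - 1) * Real.exp (-(p * r ^ 2)) * hyp0F1Neg a (c * r ^ 2)
      = Real.Gamma a / 2 * p ^ (-a) * Real.exp (-(c / p)) := by
  have h := integral_comp_rpow_Ioi
    (fun t : ℝ => t ^ (a - 1) * Real.exp (-(p * t)) * hyp0F1Neg a (c * t)) (two_ne_zero (α := ℝ))
  rw [integral_rpow_mul_exp_mul_hyp0F1Neg ha hp c] at h
  rw [setIntegral_congr_fun (g := fun r => 2 * (r ^ (2 * a - 1) * Real.exp (-(p * r ^ 2)) *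
    hyp0F1Neg a (c * r ^ 2))) measurableSet_Ioi, integral_const_mul] at h
  · linarith
  · intro r hr
    have hr' : (0:ℝ) < r := hr
    simp only [abs_two, smul_eq_mul]
    rw [← Real.rpow_mul hr'.le, show 2 * a - 1 = (2 - 1) + 2 * (a - 1) by ring,
      Real.rpow_add hr', Real.rpow_two]
    ring

lemma integrable_beta_moment {a b : ℝ} (ha : 0 < a) (hb : 0 < b) (k : ℕ) :
    IntegrableOn (fun z : ℝ => z ^ (a - 1) * (1 + z) ^ (-(a + b)) * (z / (1 + z) ^ 2) ^ k)
      (Set.Ioi 0) ∧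
    ∫ z in Set.Ioi (0:ℝ), z ^ (a - 1) * (1 + z) ^ (-(a + b)) * (z / (1 + z) ^ 2) ^ k
      = Real.Gamma a * Real.Gamma b / Real.Gamma (a + b) *
        (poch a k * poch b k /
          (4 ^ k * poch ((a + b) / 2) k * poch ((a + b) / 2 + 1 / 2) k)) := by
  have hW : ∀ z ∈ Set.Ioi (0:ℝ),
      z ^ (a - 1) * (1 + z) ^ (-(a + b)) * (z / (1 + z) ^ 2) ^ k
        = z ^ (a + k - 1) * (1 + z) ^ (-((a + k) + (b + k))) := by
    intro z hz
    have hz' : (0:ℝ) < z := hz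
    have hz1 : 0 < 1 + z := by linarith
    rw [show a + k - 1 = (a - 1) + k by ring,
      show -((a + k) + (b + k)) = -(a + b) + -((2 * k : ℕ) : ℝ) by push_cast; ring,
      Real.rpow_add hz', Real.rpow_add hz1, Real.rpow_neg hz1.le ((2 * k : ℕ) : ℝ),
      Real.rpow_natCast, Real.rpow_natCast, div_pow, ← pow_mul]
    ring
  obtain ⟨h1, h2⟩ := integrable_beta (a := a + k) (b := b + k) (by positivity) (by positivity)
  refine ⟨(integrableOn_congr_fun hW measurableSet_Ioi).2 h1, ?_⟩
  have hab : 0 < a + b := by linarith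
  have hd := poch_two_mul ((a + b) / 2) k
  rw [show 2 * ((a + b) / 2) = a + b by ring] at hd
  rw [setIntegral_congr_fun measurableSet_Ioi hW, h2, Gamma_add_nat ha, Gamma_add_nat hb,
    show a + k + (b + k) = a + b + ((2 * k : ℕ) : ℝ) by push_cast; ring, Gamma_add_nat hab, ← hd]
  have h3 := poch_pos hab (2 * k)
  have h4 := Real.Gamma_pos_of_pos hab
  field_simp

lemma hyp2F2_eq_integral {a b c : ℝ} (ha : 0 < a) (hb : 0 < b) (hc : 0 < c) (x : ℝ) :
    ∫ q, (q.1 ^ (c - 1) * Real.exp (-(1 * q.1))) * (q.2 ^ (a - 1) * (1 + q.2) ^ (-(a + b))) *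
        hyp0F1Neg a (x * (q.1 * (q.2 / (1 + q.2) ^ 2)))
        ∂((volume.restrict (Set.Ioi (0:ℝ))).prod (volume.restrict (Set.Ioi (0:ℝ))))
      = Real.Gamma a * Real.Gamma b * Real.Gamma c / Real.Gamma (a + b) *
        hyp2F2 b c ((a + b) / 2) ((a + b) / 2 + 1 / 2) (-x / 4) := by
  have hW : ∀ k : ℕ, ∀ t ∈ Set.Ioi (0:ℝ), t ^ (c - 1) * Real.exp (-(1 * t)) * t ^ k
        = t ^ (c + k - 1) * Real.exp (-(1 * t)) := by
    intro k t ht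
    rw [show c + k - 1 = (c - 1) + k by ring, Real.rpow_add ht, Real.rpow_natCast]
    ring
  have hI : ∀ k : ℕ, IntegrableOn (fun t : ℝ => t ^ (c - 1) * Real.exp (-(1 * t)) * t ^ k)
      (Set.Ioi 0) := fun k =>
    (integrableOn_congr_fun (hW k) measurableSet_Ioi).2
      (integrableOn_rpow_mul_exp_neg (a := c + k) (by positivity) one_pos)
  have hV : ∀ k : ℕ, ∫ t in Set.Ioi (0:ℝ), t ^ (c - 1) * Real.exp (-(1 * t)) * t ^ k
        = Real.Gamma c * poch c k := by
    intro k
    rw [setIntegral_congr_fun measurableSet_Ioi (hW k),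
      integral_rpow_mul_exp_neg (a := c + k) (by positivity) one_pos, Gamma_add_nat hc,
      Real.one_rpow, mul_one]
  have hsplit : ∀ (k : ℕ) (q : ℝ × ℝ),
      (q.1 ^ (c - 1) * Real.exp (-(1 * q.1))) * (q.2 ^ (a - 1) * (1 + q.2) ^ (-(a + b))) *
        (q.1 * (q.2 / (1 + q.2) ^ 2)) ^ k
      = (q.1 ^ (c - 1) * Real.exp (-(1 * q.1)) * q.1 ^ k) *
        (q.2 ^ (a - 1) * (1 + q.2) ^ (-(a + b)) * (q.2 / (1 + q.2) ^ 2) ^ k) := by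
    intro k q
    rw [mul_pow]; ring
  have hco : ∀ (y : ℝ) (k : ℕ), y ^ k / (k.factorial * poch a k) *
      (Real.Gamma c * poch c k * (Real.Gamma a * Real.Gamma b / Real.Gamma (a + b) *
        (poch a k * poch b k /
          (4 ^ k * poch ((a + b) / 2) k * poch ((a + b) / 2 + 1 / 2) k))))
      = Real.Gamma a * Real.Gamma b * Real.Gamma c / Real.Gamma (a + b) *
        (poch b k * poch c k / (poch ((a + b) / 2) k * poch ((a + b) / 2 + 1 / 2) k *
          k.factorial) * (y / 4) ^ k) := by
    intro y k
    have h2 := poch_pos ha k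
    have h3 := poch_pos (a := (a + b) / 2) (by positivity) k
    have h4 := poch_pos (a := (a + b) / 2 + 1 / 2) (by positivity) k
    rw [div_pow]
    field_simp
  have hpos : ∀ᵐ q ∂((volume.restrict (Set.Ioi (0:ℝ))).prod (volume.restrict (Set.Ioi (0:ℝ)))),
      0 < q.1 ∧ 0 < q.2 := by
    rw [Measure.prod_restrict]
    filter_upwards [ae_restrict_mem (measurableSet_Ioi.prod measurableSet_Ioi)] with q hq
    exact hq
  rw [integral_mul_hyp0F1Neg (w := fun q : ℝ × ℝ => (q.1 ^ (c - 1) * Real.exp (-(1 * q.1))) *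
      (q.2 ^ (a - 1) * (1 + q.2) ^ (-(a + b))))
    (g := fun q => q.1 * (q.2 / (1 + q.2) ^ 2)) (M := fun k =>
      Real.Gamma c * poch c k * (Real.Gamma a * Real.Gamma b / Real.Gamma (a + b) *
        (poch a k * poch b k /
          (4 ^ k * poch ((a + b) / 2) k * poch ((a + b) / 2 + 1 / 2) k)))) ha x ?_ ?_ ?_ ?_ ?_]
  · simp only [hco]
    rw [tsum_mul_left, hyp2F2]
  · filter_upwards [hpos] with q ⟨h1, h2⟩
    positivity
  · filter_upwards [hpos] with q ⟨h1, h2⟩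
    positivity
  · intro k
    simp only [hsplit]
    exact (hI k).mul_prod (integrable_beta_moment ha hb k).1
  · intro k
    simp only [hsplit]
    rw [integral_prod_mul (fun s : ℝ => s ^ (c - 1) * Real.exp (-(1 * s)) * s ^ k)
      (fun z : ℝ => z ^ (a - 1) * (1 + z) ^ (-(a + b)) * (z / (1 + z) ^ 2) ^ k), hV,
      (integrable_beta_moment ha hb k).2]
  · simp only [hco]
    exact (summable_poch_ratio hb hc (by positivity) (by positivity) (by positivity)).mul_left _

lemma hyp3F2_eq_integral {a b c : ℝ} (ha : 0 < a) (hb : 0 < b) (hc : 0 < c) {H : ℝ}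
    (hH : 0 ≤ H) :
    Real.Gamma a * Real.Gamma b / Real.Gamma (a + b) *
        hyp3F2 a b c ((a + b) / 2) ((a + b) / 2 + 1 / 2) (-H / 4)
      = ∫ z in Set.Ioi (0:ℝ), z ^ (a - 1) * (1 + z) ^ (-(a + b)) *
          (1 + H * (z / (1 + z) ^ 2)) ^ (-c) := by
  set m : Measure ℝ := volume.restrict (Set.Ioi (0:ℝ)) with hm
  have hGa := Real.Gamma_pos_of_pos ha
  have hGb := Real.Gamma_pos_of_pos hb
  have hGc := Real.Gamma_pos_of_pos hc
  have hGab := Real.Gamma_pos_of_pos (add_pos ha hb)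
  have hmpos : ∀ᵐ t ∂m, 0 < t := ae_restrict_mem measurableSet_Ioi
  have hpos3 : ∀ᵐ q ∂(m.prod (m.prod m)), 0 < q.1 ∧ 0 < q.2.1 ∧ 0 < q.2.2 := by
    rw [hm, Measure.prod_restrict, Measure.prod_restrict]
    filter_upwards [ae_restrict_mem
      (measurableSet_Ioi.prod (measurableSet_Ioi.prod measurableSet_Ioi))] with q hq
    exact hq
  have hg : ∀ z : ℝ, 0 < z → z / (1 + z) ^ 2 ≤ 1 := by
    intro z hz
    rw [div_le_one (by positivity)]; nlinarith
  have hlin : ∀ e : ℝ, 0 < e →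
      Integrable (fun t : ℝ => t ^ (e - 1) * Real.exp (-(1 * t)) * (1 + t)) m := by
    intro e he
    have h1 := integrableOn_rpow_mul_exp_neg he one_pos
    have h2 := integrableOn_rpow_mul_exp_neg (a := e + 1) (by linarith) one_pos
    refine (h1.add h2).congr ?_
    filter_upwards [hmpos] with t ht
    simp only [Pi.add_apply]
    rw [show e + 1 - 1 = (e - 1) + 1 by ring, Real.rpow_add ht, Real.rpow_one]
    ring
  set f : ℝ → ℝ × ℝ → ℝ := fun t q => t ^ (a - 1) * Real.exp (-(1 * t)) *
    ((q.1 ^ (c - 1) * Real.exp (-(1 * q.1))) * (q.2 ^ (a - 1) * (1 + q.2) ^ (-(a + b))) *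
        hyp0F1Neg a (H * t * (q.1 * (q.2 / (1 + q.2) ^ 2)))) with hf
  have hfi : Integrable (Function.uncurry f) (m.prod (m.prod m)) := by
    refine Integrable.mono' (((hlin a ha).mul_prod ((hlin c hc).mul_prod
      (integrable_beta ha hb).1)).const_mul ((1 + 1 / (a * (a + 1))) * (1 + H))) ?_ ?_
    · have := measurable_hyp0F1Neg ha
      refine Measurable.aestronglyMeasurable ?_
      simp only [hf, Function.uncurry_def]
      fun_prop
    · filter_upwards [hpos3] with ⟨t, s, z⟩ ⟨ht, hs, hz⟩
      simp only at ht hs hz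
      have hbd := abs_hyp0F1Neg_le (z := H * t * (s * (z / (1 + z) ^ 2))) ha (by positivity)
      have hz1 := hg z hz
      have hz0 : 0 ≤ z / (1 + z) ^ 2 := by positivity
      have hle : 1 + H * t * (s * (z / (1 + z) ^ 2)) ≤ (1 + H) * (1 + t) * (1 + s) := by
        have : H * t * (s * (z / (1 + z) ^ 2)) ≤ H * t * (s * 1) := by gcongr
        have h2 : 0 ≤ H * t := by positivity
        have h3 : 0 ≤ H * s := by positivity
        have h4 : 0 ≤ t * s := by positivity
        nlinarith
      simp only [hf, Function.uncurry]
      rw [norm_mul (t ^ (a - 1) * Real.exp (-(1 * t))), norm_mul (s ^ (c - 1) * _ * _),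
        Real.norm_of_nonneg (by positivity : 0 ≤ t ^ (a - 1) * Real.exp (-(1 * t))),
        Real.norm_of_nonneg (by positivity : 0 ≤ s ^ (c - 1) * Real.exp (-(1 * s)) *
          (z ^ (a - 1) * (1 + z) ^ (-(a + b)))), Real.norm_eq_abs]
      calc _ ≤ t ^ (a - 1) * Real.exp (-(1 * t)) * (s ^ (c - 1) * Real.exp (-(1 * s)) *
          (z ^ (a - 1) * (1 + z) ^ (-(a + b))) *
            ((1 + 1 / (a * (a + 1))) * ((1 + H) * (1 + t) * (1 + s)))) := by
            gcongr
            exact hbd.trans (by gcongr)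
        _ = _ := by ring
  have hleft : ∀ t : ℝ, 0 < t → ∫ q, f t q ∂(m.prod m)
      = Real.Gamma a * Real.Gamma b * Real.Gamma c / Real.Gamma (a + b) *
        (Real.exp (-t) * t ^ (a - 1) *
          hyp2F2 b c ((a + b) / 2) ((a + b) / 2 + 1 / 2) (-H / 4 * t)) := by
    intro t ht
    simp only [hf]
    rw [integral_const_mul, hyp2F2_eq_integral ha hb hc,
      show -(H * t) / 4 = -H / 4 * t by ring, one_mul]
    ring
  have hright : ∀ q : ℝ × ℝ, ∫ t, f t q ∂m
      = Real.Gamma a * ((q.1 ^ (c - 1) * Real.exp (-((1 + H * (q.2 / (1 + q.2) ^ 2)) * q.1))) *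
        (q.2 ^ (a - 1) * (1 + q.2) ^ (-(a + b)))) := by
    intro q
    have h1 : ∀ t : ℝ, f t q = ((q.1 ^ (c - 1) * Real.exp (-(1 * q.1))) *
        (q.2 ^ (a - 1) * (1 + q.2) ^ (-(a + b)))) * (t ^ (a - 1) * Real.exp (-(1 * t)) *
          hyp0F1Neg a ((H * (q.1 * (q.2 / (1 + q.2) ^ 2))) * t)) := by
      intro t
      simp only [hf]
      rw [show H * t * (q.1 * (q.2 / (1 + q.2) ^ 2))
        = (H * (q.1 * (q.2 / (1 + q.2) ^ 2))) * t by ring]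
      ring
    simp only [h1]
    rw [integral_const_mul, hm, integral_rpow_mul_exp_mul_hyp0F1Neg ha one_pos,
      show -((1 + H * (q.2 / (1 + q.2) ^ 2)) * q.1)
        = -(1 * q.1) + -(H * (q.1 * (q.2 / (1 + q.2) ^ 2)) / 1) by ring, Real.exp_add,
      Real.one_rpow]
    ring
  have hswap := integral_integral_swap hfi
  have hri := hfi.integral_prod_right
  simp only [Function.uncurry, hright] at hri
  have hri' : Integrable (fun q : ℝ × ℝ =>
      (q.1 ^ (c - 1) * Real.exp (-((1 + H * (q.2 / (1 + q.2) ^ 2)) * q.1))) *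
        (q.2 ^ (a - 1) * (1 + q.2) ^ (-(a + b)))) (m.prod m) := by
    refine (hri.const_mul (Real.Gamma a)⁻¹).congr (Filter.Eventually.of_forall fun q => ?_)
    simp only
    rw [inv_mul_cancel_left₀ hGa.ne']
  have hval : ∫ q : ℝ × ℝ, (q.1 ^ (c - 1) * Real.exp (-((1 + H * (q.2 / (1 + q.2) ^ 2)) * q.1))) *
        (q.2 ^ (a - 1) * (1 + q.2) ^ (-(a + b))) ∂(m.prod m)
      = Real.Gamma c * ∫ z, z ^ (a - 1) * (1 + z) ^ (-(a + b)) *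
          (1 + H * (z / (1 + z) ^ 2)) ^ (-c) ∂m := by
    rw [integral_prod_symm _ hri', ← integral_const_mul]
    refine integral_congr_ae ?_
    filter_upwards [hmpos] with z hz
    rw [integral_mul_const, hm, integral_rpow_mul_exp_neg hc (by positivity)]
    ring
  simp only [hright] at hswap
  rw [integral_congr_ae (hmpos.mono hleft), integral_const_mul, integral_const_mul, hval] at hswap
  rw [hyp3F2, ← hm]
  set T := ∫ t, Real.exp (-t) * t ^ (a - 1) *
    hyp2F2 b c ((a + b) / 2) ((a + b) / 2 + 1 / 2) (-H / 4 * t) ∂m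
  refine mul_left_cancel₀ (mul_ne_zero hGa.ne' hGc.ne') ?_
  rw [mul_assoc (Real.Gamma a) (Real.Gamma c) (∫ z, _ ∂m), ← hswap]
  field_simp

lemma besselJ_eq_hyp0F1Neg {δ w : ℝ} (hδ : 0 < δ + 1) (hw : 0 < w) :
    besselJ δ w = (w / 2) ^ δ / Real.Gamma (δ + 1) * hyp0F1Neg (δ + 1) ((w / 2) ^ 2) := by
  rw [besselJ, hyp0F1Neg, ← tsum_mul_left]
  refine tsum_congr fun k => ?_
  have h1 := Real.Gamma_pos_of_pos hδ
  have h2 := poch_pos hδ k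
  rw [Gamma_add_nat hδ, show δ + 2 * (k:ℝ) = δ + ((2 * k : ℕ) : ℝ) by push_cast; ring,
    Real.rpow_add (by positivity), Real.rpow_natCast, pow_mul, neg_pow ((w / 2) ^ 2)]
  field_simp

lemma integrableOn_rpow_mul_exp_neg_add_inv (μ : ℝ) {q : ℝ} (hq : 0 < q) :
    IntegrableOn (fun x : ℝ => x ^ (μ - 1) * Real.exp (-(q * (x + x⁻¹)))) (Set.Ioi 0) := by
  obtain ⟨n, hn⟩ := exists_nat_gt (-μ)
  refine Integrable.mono' ((integrableOn_rpow_mul_exp_neg (a := μ + n) (by linarith) hq).const_mul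
    (n.factorial / q ^ n)) (Measurable.aestronglyMeasurable (by fun_prop)) ?_
  filter_upwards [ae_restrict_mem measurableSet_Ioi] with x (hx : (0:ℝ) < x)
  have hb : Real.exp (-(q * x⁻¹)) ≤ n.factorial / q ^ n * x ^ n := by
    have := Real.pow_div_factorial_le_exp (q * x⁻¹) (by positivity) n
    rw [Real.exp_neg]
    calc _ ≤ ((q * x⁻¹) ^ n / n.factorial)⁻¹ := inv_anti₀ (by positivity) this
      _ = _ := by rw [mul_pow, inv_pow]; field_simp
  rw [Real.norm_of_nonneg (by positivity), mul_add, neg_add, Real.exp_add,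
    show μ + n - 1 = (μ - 1) + n by ring, Real.rpow_add hx, Real.rpow_natCast]
  calc _ ≤ x ^ (μ - 1) * (Real.exp (-(q * x)) * (n.factorial / q ^ n * x ^ n)) := by gcongr
    _ = _ := by ring

lemma two_mul_besselK (μ : ℝ) {r : ℝ} (hr : 0 < r) :
    2 * besselK μ r
      = ∫ x in Set.Ioi (0:ℝ), x ^ (μ - 1) * Real.exp (-(r / 2 * (x + x⁻¹))) := by
  set f : ℝ → ℝ := fun u => Real.exp (-r * Real.cosh u) * Real.exp (μ * u) with hf
  have hcomp : ∀ u : ℝ, |Real.exp u| •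
      (Real.exp u ^ (μ - 1) * Real.exp (-(r / 2 * (Real.exp u + (Real.exp u)⁻¹)))) = f u := by
    intro u
    rw [Real.abs_exp, smul_eq_mul, ← Real.exp_mul, ← Real.exp_neg, ← mul_assoc, ← Real.exp_add,
      mul_comm, hf]
    simp only
    rw [Real.cosh_eq]
    congr 2 <;> ring
  have himg : Real.exp '' Set.univ = Set.Ioi 0 := by rw [Set.image_univ, Real.range_exp]
  have hder : ∀ u ∈ Set.univ, HasDerivWithinAt Real.exp (Real.exp u) Set.univ u :=
    fun u _ => (Real.hasDerivAt_exp u).hasDerivWithinAt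
  have hfi : Integrable f := by
    have := (integrableOn_image_iff_integrableOn_abs_deriv_smul MeasurableSet.univ hder
      Real.exp_injective.injOn
      (fun x => x ^ (μ - 1) * Real.exp (-(r / 2 * (x + x⁻¹))))).1
      (by rw [himg]; exact integrableOn_rpow_mul_exp_neg_add_inv μ (by positivity))
    simp only [hcomp, integrableOn_univ] at this
    exact this
  rw [← himg, integral_image_eq_integral_abs_deriv_smul MeasurableSet.univ hder
    Real.exp_injective.injOn]
  simp only [hcomp, setIntegral_univ]
  have h1 : ∫ u, f (-u) = ∫ u, f u := integral_neg_eq_self f volume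
  have h2 := integral_add hfi hfi.comp_neg
  have h3 : ∀ u, f u + f (-u) = 2 * (Real.exp (-r * Real.cosh |u|) * Real.cosh (μ * |u|)) := by
    intro u
    have : Real.cosh (μ * |u|) = Real.cosh (μ * u) := by
      rw [← Real.cosh_abs, abs_mul, abs_abs, ← abs_mul, Real.cosh_abs]
    rw [this, Real.cosh_abs, Real.cosh_eq (μ * u), hf]
    simp only [Real.cosh_neg, mul_neg]
    ring
  simp only [h3, h1] at h2
  rw [integral_const_mul, integral_comp_abs
    (f := fun u => Real.exp (-r * Real.cosh u) * Real.cosh (μ * u))] at h2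
  rw [besselK]
  linarith

lemma rpow_mul_besselK (μ : ℝ) {r t : ℝ} (hr : 0 < r) (ht : 0 < t) :
    ∫ z in Set.Ioi (0:ℝ), z ^ (μ - 1) * Real.exp (-(t * z)) * Real.exp (-(r ^ 2 / (4 * t * z)))
      = 2 ^ (1 - μ) * t ^ (-μ) * (r ^ μ * besselK μ r) := by
  have hb : 0 < 2 * t / r := by positivity
  have h := integral_comp_mul_left_Ioi
    (fun x : ℝ => x ^ (μ - 1) * Real.exp (-(r / 2 * (x + x⁻¹)))) 0 hb
  rw [mul_zero, ← two_mul_besselK μ hr, setIntegral_congr_fun (g := fun z =>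
    (2 * t / r) ^ (μ - 1) * (z ^ (μ - 1) * Real.exp (-(t * z)) *
      Real.exp (-(r ^ 2 / (4 * t * z))))) measurableSet_Ioi, integral_const_mul, smul_eq_mul] at h
  · have h1 : (2 * t / r) ^ (μ - 1) ≠ 0 := by positivity
    refine mul_left_cancel₀ h1 (h.trans ?_)
    have h2 : (2 * t / r) ^ (μ - 1) = 2 ^ μ * t ^ μ / r ^ μ * (2 * t / r)⁻¹ := by
      rw [Real.rpow_sub hb, Real.rpow_one, Real.div_rpow (by positivity) hr.le,
        Real.mul_rpow two_pos.le ht.le, div_eq_mul_inv]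
    rw [h2, Real.rpow_sub two_pos, Real.rpow_one, Real.rpow_neg ht.le]
    field_simp
  · intro z hz
    have hz' : (0:ℝ) < z := hz
    simp only
    rw [Real.mul_rpow hb.le hz'.le, mul_assoc, mul_assoc (z ^ (μ - 1)), ← Real.exp_add]
    congr 3
    field_simp
    ring

lemma abs_hyp0F1Neg_mul_exp_le {d h r t z : ℝ} (hd : 0 < d) (hr : 0 < r) (ht : 0 < t)
    (hz : 0 < z) :
    |hyp0F1Neg d (h ^ 2 / 4 * r ^ 2)| *
        (Real.exp (-((1 + z) * t)) * Real.exp (-((1 + z) / (4 * t * z) * r ^ 2)))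
      ≤ (1 + 1 / (d * (d + 1))) * (1 + 2 * h ^ 2) *
        (Real.exp (-((1 + z) / 2 * t)) * Real.exp (-((1 + z) / (8 * t * z) * r ^ 2))) := by
  have h1 := abs_hyp0F1Neg_le (z := h ^ 2 / 4 * r ^ 2) hd (by positivity)
  have h2 : 1 + h ^ 2 / 4 * r ^ 2 ≤ (1 + 2 * h ^ 2) * Real.exp (r / 2) := by
    have e1 := Real.one_le_exp (x := r / 2) (by positivity)
    have e2 := Real.pow_div_factorial_le_exp (r / 2) (by positivity) 2
    norm_num [Nat.factorial] at e2
    have e3 : h ^ 2 * ((r / 2) ^ 2 / 2) ≤ h ^ 2 * Real.exp (r / 2) := by gcongr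
    nlinarith
  have h3 : r / 2 + (-((1 + z) * t) + -((1 + z) / (4 * t * z) * r ^ 2))
      ≤ -((1 + z) / 2 * t) + -((1 + z) / (8 * t * z) * r ^ 2) := by
    have e1 : r / 2 ≤ t / 2 + r ^ 2 / (8 * t) := by
      have : t / 2 + r ^ 2 / (8 * t) - r / 2 = (2 * t - r) ^ 2 / (8 * t) := by
        field_simp; ring
      have : 0 ≤ (2 * t - r) ^ 2 / (8 * t) := by positivity
      linarith
    have e2 : (1 + z) / (4 * t * z) * r ^ 2 = 2 * ((1 + z) / (8 * t * z) * r ^ 2) := by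
      field_simp; ring
    have e3 : (1 + z) / (8 * t * z) * r ^ 2 = r ^ 2 / (8 * t) + r ^ 2 / (8 * t * z) := by
      field_simp; ring
    have e4 : 0 ≤ r ^ 2 / (8 * t * z) := by positivity
    have e5 : 0 ≤ z * t := by positivity
    rw [e2]
    linarith
  calc _ ≤ (1 + 1 / (d * (d + 1))) * ((1 + 2 * h ^ 2) * Real.exp (r / 2)) *
        (Real.exp (-((1 + z) * t)) * Real.exp (-((1 + z) / (4 * t * z) * r ^ 2))) := by
        gcongr
        exact h1.trans (by gcongr)
    _ = (1 + 1 / (d * (d + 1))) * (1 + 2 * h ^ 2) *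
        Real.exp (r / 2 + (-((1 + z) * t) + -((1 + z) / (4 * t * z) * r ^ 2))) := by
        rw [Real.exp_add, Real.exp_add]; ring
    _ ≤ _ := by
        rw [← Real.exp_add]
        gcongr

lemma rpow_neg_scale {d k t z : ℝ} (hk : 0 < k) (ht : 0 < t) (hz : 0 < z) :
    ((1 + z) / (k * t * z)) ^ (-d) = k ^ d * t ^ d * z ^ d * (1 + z) ^ (-d) := by
  rw [Real.div_rpow (by positivity) (by positivity), Real.rpow_neg (by positivity : 0 ≤ k * t * z),
    Real.mul_rpow (by positivity) hz.le, Real.mul_rpow hk.le ht.le]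
  field_simp

section BesselProduct

variable {μ ν d : ℝ}

lemma integrable_dominating (hd : 0 < d) (hμ : 0 < μ + d) (hν : 0 < ν + d) (hc : 0 < μ + ν + d) :
    Integrable (fun q : ℝ × ℝ × ℝ => q.1 ^ (2 * d - 1) * (q.2.1 ^ (μ + ν - 1) * q.2.2 ^ (μ - 1)) *
        (Real.exp (-((1 + q.2.2) / 2 * q.2.1)) *
          Real.exp (-((1 + q.2.2) / (8 * q.2.1 * q.2.2) * q.1 ^ 2))))
      ((volume.restrict (Set.Ioi (0:ℝ))).prod
        ((volume.restrict (Set.Ioi (0:ℝ))).prod (volume.restrict (Set.Ioi (0:ℝ))))) := by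
  have hpos : ∀ᵐ q ∂((volume.restrict (Set.Ioi (0:ℝ))).prod (volume.restrict (Set.Ioi (0:ℝ)))),
      0 < q.1 ∧ 0 < q.2 := by
    rw [Measure.prod_restrict]
    filter_upwards [ae_restrict_mem (measurableSet_Ioi.prod measurableSet_Ioi)] with q hq
    exact hq
  have hsplit : ∀ r t z : ℝ, r ^ (2 * d - 1) * (t ^ (μ + ν - 1) * z ^ (μ - 1)) *
      (Real.exp (-((1 + z) / 2 * t)) * Real.exp (-((1 + z) / (8 * t * z) * r ^ 2)))
      = (t ^ (μ + ν - 1) * z ^ (μ - 1) * Real.exp (-((1 + z) / 2 * t))) *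
        (r ^ (2 * d - 1) * Real.exp (-((1 + z) / (8 * t * z) * r ^ 2))) := by
    intros; ring
  refine integrable_prod_of_integral_left (g := fun q => Real.Gamma d / 2 * 8 ^ d *
    ((q.1 ^ (μ + ν + d - 1) * Real.exp (-((1 + q.2) / 2 * q.1))) *
      (q.2 ^ (μ + d - 1) * (1 + q.2) ^ (-d)))) (by fun_prop) ?_ ?_ ?_ (Integrable.const_mul ?_ _)
  · filter_upwards [hpos] with q ⟨h1, h2⟩ r (hr : (0:ℝ) < r)
    positivity
  · filter_upwards [hpos] with ⟨t, z⟩ ⟨ht, hz⟩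
    simp only at ht hz
    simp only [hsplit]
    exact (integrableOn_rpow_mul_exp_neg_sq hd (by positivity)).const_mul _
  · filter_upwards [hpos] with ⟨t, z⟩ ⟨ht, hz⟩
    simp only at ht hz
    simp only [hsplit]
    rw [integral_const_mul, integral_rpow_mul_exp_neg_sq hd (by positivity),
      rpow_neg_scale (by norm_num) ht hz, show μ + ν + d - 1 = (μ + ν - 1) + d by ring,
      show μ + d - 1 = (μ - 1) + d by ring, Real.rpow_add ht, Real.rpow_add hz]
    ring
  · refine integrable_prod_of_integral_left (g := fun z => Real.Gamma (μ + ν + d) *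
      2 ^ (μ + ν + d) * (z ^ (μ + d - 1) * (1 + z) ^ (-(μ + d + (ν + d))))) (by fun_prop)
      ?_ ?_ ?_ ((integrable_beta hμ hν).1.const_mul _)
    · filter_upwards [ae_restrict_mem measurableSet_Ioi] with z (hz : (0:ℝ) < z) t (ht : (0:ℝ) < t)
      positivity
    · filter_upwards [ae_restrict_mem measurableSet_Ioi] with z (hz : (0:ℝ) < z)
      exact (integrableOn_rpow_mul_exp_neg hc (by positivity)).mul_const _
    · filter_upwards [ae_restrict_mem measurableSet_Ioi] with z (hz : (0:ℝ) < z)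
      rw [integral_mul_const, integral_rpow_mul_exp_neg hc (by positivity),
        Real.div_rpow (by positivity) two_pos.le, Real.rpow_neg two_pos.le, div_inv_eq_mul,
        show -(μ + d + (ν + d)) = -(μ + ν + d) + -d by ring,
        Real.rpow_add (by positivity : (0:ℝ) < 1 + z)]
      ring

/-- The Gaussian mixture whose integral over `(t, z)` is the product of the Bessel functions. -/
noncomputable def besselKernel (h μ ν d r : ℝ) (q : ℝ × ℝ) : ℝ :=
  r ^ (2 * d - 1) * (q.1 ^ (μ + ν - 1) * q.2 ^ (μ - 1)) *
    (hyp0F1Neg d (h ^ 2 / 4 * r ^ 2) *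
      (Real.exp (-((1 + q.2) * q.1)) * Real.exp (-((1 + q.2) / (4 * q.1 * q.2) * r ^ 2))))

lemma integrable_besselKernel (h : ℝ) (hd : 0 < d) (hμ : 0 < μ + d) (hν : 0 < ν + d)
    (hc : 0 < μ + ν + d) :
    Integrable (Function.uncurry (besselKernel h μ ν d))
      ((volume.restrict (Set.Ioi (0:ℝ))).prod
        ((volume.restrict (Set.Ioi (0:ℝ))).prod (volume.restrict (Set.Ioi (0:ℝ))))) := by
  refine Integrable.mono' ((integrable_dominating hd hμ hν hc).const_mul
    ((1 + 1 / (d * (d + 1))) * (1 + 2 * h ^ 2))) ?_ ?_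
  · have := measurable_hyp0F1Neg hd
    refine Measurable.aestronglyMeasurable ?_
    simp only [besselKernel, Function.uncurry_def]
    fun_prop
  · rw [Measure.prod_restrict, Measure.prod_restrict]
    filter_upwards [ae_restrict_mem
      (measurableSet_Ioi.prod (measurableSet_Ioi.prod measurableSet_Ioi))] with ⟨r, t, z⟩ hq
    have hr : (0:ℝ) < r := hq.1
    have ht : (0:ℝ) < t := hq.2.1
    have hz : (0:ℝ) < z := hq.2.2
    simp only [Function.uncurry, besselKernel]
    rw [norm_mul, Real.norm_of_nonneg (by positivity :
      0 ≤ r ^ (2 * d - 1) * (t ^ (μ + ν - 1) * z ^ (μ - 1))), norm_mul,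
      Real.norm_eq_abs (hyp0F1Neg _ _),
      Real.norm_of_nonneg (by positivity)]
    calc _ ≤ r ^ (2 * d - 1) * (t ^ (μ + ν - 1) * z ^ (μ - 1)) * _ :=
          mul_le_mul_of_nonneg_left (abs_hyp0F1Neg_mul_exp_le (h := h) hd hr ht hz) (by positivity)
      _ = _ := by ring

lemma integral_integral_besselKernel (h : ℝ) {r : ℝ} (hr : 0 < r) :
    ∫ t in Set.Ioi (0:ℝ), ∫ z in Set.Ioi (0:ℝ), besselKernel h μ ν d r (t, z)
      = 2 ^ (2 - μ - ν) * (r ^ (μ + ν + 2 * d - 1) * hyp0F1Neg d (h ^ 2 / 4 * r ^ 2) *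
        besselK μ r * besselK ν r) := by
  have hin : ∀ t ∈ Set.Ioi (0:ℝ), ∫ z in Set.Ioi (0:ℝ), besselKernel h μ ν d r (t, z)
      = r ^ (2 * d - 1) * hyp0F1Neg d (h ^ 2 / 4 * r ^ 2) * (2 ^ (1 - μ) * (r ^ μ * besselK μ r)) *
        (t ^ (ν - 1) * Real.exp (-(1 * t)) * Real.exp (-(r ^ 2 / (4 * 1 * t)))) := by
    intro t (ht : (0:ℝ) < t)
    rw [setIntegral_congr_fun (g := fun z => r ^ (2 * d - 1) * hyp0F1Neg d (h ^ 2 / 4 * r ^ 2) *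
      (t ^ (μ + ν - 1) * Real.exp (-(1 * t)) * Real.exp (-(r ^ 2 / (4 * 1 * t)))) *
      (z ^ (μ - 1) * Real.exp (-(t * z)) * Real.exp (-(r ^ 2 / (4 * t * z))))) measurableSet_Ioi,
      integral_const_mul, rpow_mul_besselK μ hr ht,
      show μ + ν - 1 = μ + (ν - 1) by ring, Real.rpow_add ht, Real.rpow_neg ht.le]
    · have : t ^ μ ≠ 0 := by positivity
      field_simp
    · intro z (hz : (0:ℝ) < z)
      simp only [besselKernel]
      rw [show -((1 + z) * t) = -(1 * t) + -(t * z) by ring,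
        show -((1 + z) / (4 * t * z) * r ^ 2) = -(r ^ 2 / (4 * 1 * t)) + -(r ^ 2 / (4 * t * z)) by
          field_simp; ring, Real.exp_add, Real.exp_add]
      ring
  rw [setIntegral_congr_fun measurableSet_Ioi hin, integral_const_mul,
    rpow_mul_besselK ν hr one_pos, Real.one_rpow,
    show μ + ν + 2 * d - 1 = (2 * d - 1) + μ + ν by ring, Real.rpow_add hr, Real.rpow_add hr,
    show 2 - μ - ν = (1 - μ) + (1 - ν) by ring, Real.rpow_add two_pos]
  ring

lemma integral_besselKernel_left (h : ℝ) (hd : 0 < d) {t z : ℝ} (ht : 0 < t) (hz : 0 < z) :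
    ∫ r in Set.Ioi (0:ℝ), besselKernel h μ ν d r (t, z)
      = Real.Gamma d / 2 * 4 ^ d * ((z ^ (μ + d - 1) * (1 + z) ^ (-d)) * (t ^ (μ + ν + d - 1) *
        Real.exp (-(((1 + z) * (1 + h ^ 2 * (z / (1 + z) ^ 2))) * t)))) := by
  have hsplit : ∀ r : ℝ, besselKernel h μ ν d r (t, z)
      = (t ^ (μ + ν - 1) * z ^ (μ - 1) * Real.exp (-((1 + z) * t))) *
        (r ^ (2 * d - 1) * Real.exp (-((1 + z) / (4 * t * z) * r ^ 2)) *
          hyp0F1Neg d (h ^ 2 / 4 * r ^ 2)) := by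
    intro r; simp only [besselKernel]; ring
  simp only [hsplit]
  rw [integral_const_mul, integral_rpow_mul_exp_sq_mul_hyp0F1Neg hd (by positivity),
      rpow_neg_scale (by norm_num) ht hz, show μ + ν + d - 1 = (μ + ν - 1) + d by ring,
      show μ + d - 1 = (μ - 1) + d by ring, Real.rpow_add ht, Real.rpow_add hz,
      show -(((1 + z) * (1 + h ^ 2 * (z / (1 + z) ^ 2))) * t)
        = -((1 + z) * t) + -(h ^ 2 / 4 / ((1 + z) / (4 * t * z))) by field_simp; ring, Real.exp_add]
  ring

lemma integral_besselKernel (h : ℝ) (hd : 0 < d) (hμ : 0 < μ + d) (hν : 0 < ν + d)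
    (hc : 0 < μ + ν + d) :
    ∫ r in Set.Ioi (0:ℝ), ∫ q, besselKernel h μ ν d r q
        ∂((volume.restrict (Set.Ioi (0:ℝ))).prod (volume.restrict (Set.Ioi (0:ℝ))))
      = Real.Gamma d / 2 * 4 ^ d * Real.Gamma (μ + ν + d) *
        ∫ z in Set.Ioi (0:ℝ), z ^ (μ + d - 1) * (1 + z) ^ (-(μ + d + (ν + d))) *
          (1 + h ^ 2 * (z / (1 + z) ^ 2)) ^ (-(μ + ν + d)) := by
  have hfi := integrable_besselKernel h hd hμ hν hc
  have hri : Integrable (fun q => ∫ r in Set.Ioi (0:ℝ), besselKernel h μ ν d r q)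
      ((volume.restrict (Set.Ioi (0:ℝ))).prod (volume.restrict (Set.Ioi (0:ℝ)))) :=
    hfi.integral_prod_right
  rw [integral_integral_swap hfi, integral_prod_symm _ hri,
    ← integral_const_mul]
  refine setIntegral_congr_fun measurableSet_Ioi fun z (hz : (0:ℝ) < z) => ?_
  rw [setIntegral_congr_fun measurableSet_Ioi fun t (ht : (0:ℝ) < t) =>
    integral_besselKernel_left h hd ht hz, integral_const_mul, integral_const_mul,
    integral_rpow_mul_exp_neg hc (by positivity), Real.mul_rpow (by positivity) (by positivity),
    show -(μ + d + (ν + d)) = -(μ + ν + d) + -d by ring,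
    Real.rpow_add (by positivity : (0:ℝ) < 1 + z)]
  ring

end BesselProduct

/-- for `h > 0` and `δ, μ+δ, ν+δ, μ+ν+δ > −1`, the integral
`∫_0^∞ r^{μ+ν+δ+1} J_δ(hr) K_μ(r) K_ν(r) dr` converges and equals
`2^{μ+ν+δ−1} h^δ Γ(μ+δ+1)Γ(ν+δ+1)Γ(μ+ν+δ+1)/Γ(μ+ν+2δ+2) · ₃F₂(…; −h²/4)`. -/
theorem stmt10 (h μ ν δ : ℝ) (hh : 0 < h) (h1 : -1 < δ) (h2 : -1 < μ + δ)
    (h3 : -1 < ν + δ) (h4 : -1 < μ + ν + δ) :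
    IntegrableOn
      (fun r : ℝ => r ^ (μ + ν + δ + 1) * besselJ δ (h * r) * besselK μ r * besselK ν r)
      (Set.Ioi 0) ∧
    (∫ r in Set.Ioi (0:ℝ),
        r ^ (μ + ν + δ + 1) * besselJ δ (h * r) * besselK μ r * besselK ν r)
      = 2 ^ (μ + ν + δ - 1) * h ^ δ *
        (Real.Gamma (μ + δ + 1) * Real.Gamma (ν + δ + 1) * Real.Gamma (μ + ν + δ + 1) /
          Real.Gamma (μ + ν + 2 * δ + 2)) *
        hyp3F2 (μ + δ + 1) (ν + δ + 1) (μ + ν + δ + 1)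
          ((μ + ν) / 2 + δ + 1) ((μ + ν) / 2 + δ + 3 / 2) (-h ^ 2 / 4) := by
  have hd : 0 < δ + 1 := by linarith
  have hμ : 0 < μ + (δ + 1) := by linarith
  have hν : 0 < ν + (δ + 1) := by linarith
  have hc : 0 < μ + ν + (δ + 1) := by linarith
  have hfi := integrable_besselKernel h hd hμ hν hc
  set C : ℝ := (h / 2) ^ δ / Real.Gamma (δ + 1) * 2 ^ (μ + ν - 2) with hC
  have hG := Real.Gamma_pos_of_pos hd
  have hae : ∀ᵐ r ∂(volume.restrict (Set.Ioi (0:ℝ))),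
      C * (∫ q, besselKernel h μ ν (δ + 1) r q
        ∂((volume.restrict (Set.Ioi (0:ℝ))).prod (volume.restrict (Set.Ioi (0:ℝ)))))
      = r ^ (μ + ν + δ + 1) * besselJ δ (h * r) * besselK μ r * besselK ν r := by
    filter_upwards [hfi.prod_right_ae, ae_restrict_mem measurableSet_Ioi] with r hri
      (hr : (0:ℝ) < r)
    rw [integral_prod _ (show Integrable (besselKernel h μ ν (δ + 1) r) _ from hri),
      integral_integral_besselKernel h hr, besselJ_eq_hyp0F1Neg hd (by positivity),
      show μ + ν + 2 * (δ + 1) - 1 = (μ + ν + δ + 1) + δ by ring, Real.rpow_add hr,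
      show h * r / 2 = h / 2 * r by ring, Real.mul_rpow (by positivity) hr.le,
      show (h / 2 * r) ^ 2 = h ^ 2 / 4 * r ^ 2 by ring, hC,
      show 2 - μ - ν = -(μ + ν - 2) by ring, Real.rpow_neg two_pos.le]
    have : (2:ℝ) ^ (μ + ν - 2) ≠ 0 := by positivity
    field_simp
  refine ⟨(hfi.integral_prod_left.const_mul C).congr hae, ?_⟩
  rw [← integral_congr_ae hae, integral_const_mul, integral_besselKernel h hd hμ hν hc,
    ← hyp3F2_eq_integral hμ hν hc (sq_nonneg h), hC,
    show μ + (δ + 1) + (ν + (δ + 1)) = μ + ν + 2 * δ + 2 by ring,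
    show (μ + ν + 2 * δ + 2) / 2 = (μ + ν) / 2 + δ + 1 by ring,
    show (μ + ν) / 2 + δ + 1 + 1 / 2 = (μ + ν) / 2 + δ + 3 / 2 by ring,
    ← add_assoc, ← add_assoc, ← add_assoc, Real.div_rpow hh.le two_pos.le]
  have h2 : (2:ℝ) ^ (μ + ν + δ - 1) = 2 ^ (μ + ν - 2) * 4 ^ (δ + 1) / 2 ^ δ / 2 := by
    rw [show (4:ℝ) = 2 ^ (2:ℝ) by norm_num, ← Real.rpow_mul two_pos.le,
      show μ + ν + δ - 1 = (μ + ν - 2) + 2 * (δ + 1) - δ - 1 by ring, Real.rpow_sub two_pos,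
      Real.rpow_sub two_pos, Real.rpow_add two_pos, Real.rpow_one]
  rw [h2]
  field_simp
end

section
/- For real α with α > |μ| + |ν| (ensuring positivity of all Gamma arguments), ∫_0^∞ r^{α−1} K_μ(r) K_ν(r) dr = (2^{α−3}/Γ(α)) · Γ((α−μ−ν)/2) Γ((α+μ−ν)/2) Γ((α−μ+ν)/2) Γ((α+μ+ν)/2). -/
open MeasureTheory

/-- The Beta-type integral `∫ e^{bu} (cosh u)^{-a} du` over the real line. -/
theorem lintegral_exp_mul_cosh_rpow {a b : ℝ} (hab : |b| < a) :
    ∫⁻ u : ℝ, ENNReal.ofReal (Real.exp (b * u) * Real.cosh u ^ (-a)) =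
      ENNReal.ofReal (2 ^ (a - 1) *
        (Real.Gamma ((a + b) / 2) * Real.Gamma ((a - b) / 2) / Real.Gamma a)) := by
  obtain ⟨hb₁, hb₂⟩ := abs_lt.mp hab
  set p := (a + b) / 2 with hp
  set q := (a - b) / 2 with hq
  have hp0 : 0 < p := by linarith
  have hq0 : 0 < q := by linarith
  have hB := ProbabilityTheory.beta_pos hp0 hq0
  have hBeq : Real.Gamma p * Real.Gamma q / Real.Gamma a = ProbabilityTheory.beta p q := by
    rw [ProbabilityTheory.beta, show p + q = a by linarith]
  rw [hBeq]
  set B := ProbabilityTheory.beta p q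
  have hderiv (u : ℝ) : HasDerivAt (fun u => Real.sigmoid (2 * u))
      (Real.sigmoid (2 * u) * (1 - Real.sigmoid (2 * u)) * 2) u := by
    simpa [Function.comp_def] using
      (Real.hasDerivAt_sigmoid (2 * u)).comp u ((hasDerivAt_id u).const_mul 2)
  have himage : (fun u => Real.sigmoid (2 * u)) '' Set.univ = Set.Ioo 0 1 := by
    rw [← Real.range_sigmoid, Set.image_univ]
    exact (mul_left_surjective₀ (two_ne_zero : (2 : ℝ) ≠ 0)).range_comp Real.sigmoid
  have hinj : Set.InjOn (fun u => Real.sigmoid (2 * u)) Set.univ := fun x _ y _ h => by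
    simpa using Real.sigmoid_injective h
  have hpoint (u : ℝ) :
      |Real.sigmoid (2 * u) * (1 - Real.sigmoid (2 * u)) * 2| *
        (1 / B * Real.sigmoid (2 * u) ^ (p - 1) * (1 - Real.sigmoid (2 * u)) ^ (q - 1)) =
      2 ^ (1 - a) / B * (Real.exp (b * u) * Real.cosh u ^ (-a)) := by
    have hc := Real.cosh_pos u
    have hs : Real.sigmoid (2 * u) = Real.exp u / (2 * Real.cosh u) := by
      rw [Real.sigmoid_def, Real.cosh_eq, show -(2 * u) = -u + -u by ring, Real.exp_add]
      have := Real.exp_pos u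
      rw [Real.exp_neg]
      field_simp
    have hs' : 1 - Real.sigmoid (2 * u) = Real.exp (-u) / (2 * Real.cosh u) := by
      rw [hs, Real.cosh_eq]
      have := Real.exp_pos u
      have := Real.exp_pos (-u)
      field_simp
      ring
    rw [hs', hs, abs_of_pos (by positivity), Real.rpow_sub_one (by positivity),
      Real.rpow_sub_one (by positivity), Real.div_rpow (by positivity) (by positivity),
      Real.div_rpow (by positivity) (by positivity), ← Real.exp_mul, ← Real.exp_mul,
      show b * u = u * p + -u * q by rw [hp, hq]; ring, Real.exp_add,
      show -a = -p + -q by rw [hp, hq]; ring, Real.rpow_add hc,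
      show 1 - a = 1 + (-p + -q) by rw [hp, hq]; ring, Real.rpow_add two_pos,
      Real.rpow_add two_pos, Real.rpow_neg hc.le, Real.rpow_neg hc.le,
      Real.rpow_neg two_pos.le, Real.rpow_neg two_pos.le, Real.mul_rpow two_pos.le hc.le,
      Real.mul_rpow two_pos.le hc.le, Real.rpow_one]
    field_simp
  have hone := (ProbabilityTheory.lintegral_betaPDF (α := p) (β := q)).symm.trans
    (ProbabilityTheory.lintegral_betaPDF_eq_one hp0 hq0)
  rw [← himage, lintegral_image_eq_lintegral_abs_deriv_mul MeasurableSet.univ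
    (fun u _ => (hderiv u).hasDerivWithinAt) hinj, Measure.restrict_univ] at hone
  simp_rw [← ENNReal.ofReal_mul (abs_nonneg _)] at hone
  change ∫⁻ u : ℝ, ENNReal.ofReal (|Real.sigmoid (2 * u) * (1 - Real.sigmoid (2 * u)) * 2| *
        (1 / B * Real.sigmoid (2 * u) ^ (p - 1) * (1 - Real.sigmoid (2 * u)) ^ (q - 1))) = 1
    at hone
  simp_rw [hpoint] at hone
  have hk : 0 ≤ 2 ^ (1 - a) / B := by positivity
  simp_rw [ENNReal.ofReal_mul hk] at hone
  rw [lintegral_const_mul' _ _ ENNReal.ofReal_ne_top] at hone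
  have hcancel : 2 ^ (a - 1) * B * (2 ^ (1 - a) / B) = 1 := by
    rw [show 1 - a = -(a - 1) by ring, Real.rpow_neg two_pos.le]
    field_simp
  rw [← mul_one (ENNReal.ofReal (2 ^ (a - 1) * B)), ← hone, ← mul_assoc,
    ← ENNReal.ofReal_mul (by positivity), hcancel, ENNReal.ofReal_one, one_mul]

theorem integrable_exp_sub_mul_cosh (μ : ℝ) {r : ℝ} (hr : 0 < r) :
    Integrable (fun t : ℝ => Real.exp (μ * t - r * Real.cosh t)) := by
  obtain ⟨n, hn⟩ := exists_nat_gt |μ|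
  have hint : Integrable (fun u : ℝ => Real.exp (μ * u) * Real.cosh u ^ (-(n : ℝ))) := by
    refine ⟨?_, ?_⟩
    · have := Real.continuous_cosh
      exact (Measurable.aestronglyMeasurable (by fun_prop))
    · rw [hasFiniteIntegral_iff_ofReal (ae_of_all _ fun u => by
        have := Real.cosh_pos u
        positivity), lintegral_exp_mul_cosh_rpow hn]
      exact ENNReal.ofReal_lt_top
  refine (hint.const_mul (n.factorial / r ^ n)).mono'
    (Continuous.aestronglyMeasurable (by fun_prop)) (ae_of_all _ fun t => ?_)
  have hc := Real.cosh_pos t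
  have h := Real.pow_div_factorial_le_exp (r * Real.cosh t) (by positivity) n
  rw [Real.norm_of_nonneg (Real.exp_pos _).le, Real.exp_sub, Real.rpow_neg hc.le,
    Real.rpow_natCast, div_le_iff₀ (Real.exp_pos _)]
  calc Real.exp (μ * t) = n.factorial / r ^ n * (Real.exp (μ * t) * (Real.cosh t ^ n)⁻¹) *
        ((r * Real.cosh t) ^ n / n.factorial) := by
        rw [mul_pow]
        field_simp
    _ ≤ _ := by gcongr

theorem besselK_eq_integral_exp (μ : ℝ) {r : ℝ} (hr : 0 < r) :
    besselK μ r = 1 / 2 * ∫ t : ℝ, Real.exp (μ * t - r * Real.cosh t) := by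
  have hint := integrable_exp_sub_mul_cosh μ hr
  have hneg := integrable_exp_sub_mul_cosh (-μ) hr
  have hIic : ∫ t in Set.Iic (0 : ℝ), Real.exp (μ * t - r * Real.cosh t) =
      ∫ t in Set.Ioi (0 : ℝ), Real.exp (-μ * t - r * Real.cosh t) := by
    rw [← neg_zero, ← integral_comp_neg_Iic]
    simp
  rw [← intervalIntegral.integral_Iic_add_Ioi (b := 0) hint.integrableOn hint.integrableOn, hIic,
    ← integral_add hneg.integrableOn hint.integrableOn, ← integral_const_mul, besselK]
  refine integral_congr_ae (ae_of_all _ fun t => ?_)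
  simp only [sub_eq_add_neg, Real.exp_add, Real.cosh_eq (μ * t), neg_mul]
  ring

theorem ofReal_besselK (μ : ℝ) {r : ℝ} (hr : 0 < r) :
    ENNReal.ofReal (besselK μ r) =
      ENNReal.ofReal (1 / 2) * ∫⁻ t : ℝ, ENNReal.ofReal (Real.exp (μ * t - r * Real.cosh t)) := by
  rw [besselK_eq_integral_exp μ hr, ENNReal.ofReal_mul (by norm_num),
    ofReal_integral_eq_lintegral_ofReal (integrable_exp_sub_mul_cosh μ hr)
      (ae_of_all _ fun t => (Real.exp_pos _).le)]

theorem besselK_nonneg (μ r : ℝ) : 0 ≤ besselK μ r :=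
  integral_nonneg fun _ => mul_nonneg (Real.exp_pos _).le (Real.cosh_pos _).le

theorem measurable_besselK (μ : ℝ) : Measurable (besselK μ) := by
  refine StronglyMeasurable.measurable ?_
  refine StronglyMeasurable.integral_prod_right
    (f := fun r t => Real.exp (-r * Real.cosh t) * Real.cosh (μ * t)) ?_
  exact Continuous.stronglyMeasurable (by unfold Function.uncurry; fun_prop)

theorem lintegral_rpow_mul_exp_neg_mul_Ioi {a c : ℝ} (ha : 0 < a) (hc : 0 < c) :
    ∫⁻ r in Set.Ioi (0 : ℝ), ENNReal.ofReal (r ^ (a - 1) * Real.exp (-(c * r))) =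
      ENNReal.ofReal (Real.Gamma a * c ^ (-a)) := by
  have h := Real.integral_rpow_mul_exp_neg_mul_Ioi ha hc
  have hG := Real.Gamma_pos_of_pos ha
  rw [← ofReal_integral_eq_lintegral_ofReal (Integrable.of_integral_ne_zero (by
    rw [h]; positivity)) ((ae_restrict_mem measurableSet_Ioi).mono fun r (hr : 0 < r) => by
      positivity), h, one_div, Real.inv_rpow hc.le, Real.rpow_neg hc.le, mul_comm]

/-- The change of variables `s = u + v`, `t = u - v` in the plane. -/
theorem lintegral_lintegral_eq_add_sub {f : ℝ → ℝ → ENNReal}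
    (hf : Measurable (Function.uncurry f)) :
    ∫⁻ s, ∫⁻ t, f s t = 2 * ∫⁻ u, ∫⁻ v, f (u + v) (u - v) := by
  have hscale (g : ℝ → ENNReal) (hg : Measurable g) : ∫⁻ s, g s = 2 * ∫⁻ v, g (2 * v) := by
    conv_lhs => rw [← Real.smul_map_volume_mul_left (two_ne_zero : (2 : ℝ) ≠ 0)]
    rw [lintegral_smul_measure, lintegral_map hg (by fun_prop)]
    simp
  have hcomp {α : Type} [MeasurableSpace α] {x y : α → ℝ} (hx : Measurable x)
      (hy : Measurable y) : Measurable fun z => f (x z) (y z) := hf.comp (hx.prodMk hy)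
  calc ∫⁻ s, ∫⁻ t, f s t = ∫⁻ t, ∫⁻ s, f s t := lintegral_lintegral_swap hf.aemeasurable
    _ = ∫⁻ t, 2 * ∫⁻ v, f (2 * v + t) t := by
        refine lintegral_congr fun t => ?_
        rw [← lintegral_add_right_eq_self (fun s => f s t) t]
        exact hscale (fun s => f (s + t) t) (hcomp (by fun_prop) (by fun_prop))
    _ = 2 * ∫⁻ t, ∫⁻ v, f (2 * v + t) t := lintegral_const_mul' _ _ (by norm_num)
    _ = 2 * ∫⁻ v, ∫⁻ t, f (2 * v + t) t := by
        congr 1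
        exact lintegral_lintegral_swap (hcomp (by fun_prop) (by fun_prop)).aemeasurable
    _ = 2 * ∫⁻ v, ∫⁻ u, f (u + v) (u - v) := by
        congr 1
        refine lintegral_congr fun v => ?_
        rw [← lintegral_sub_right_eq_self (fun t => f (2 * v + t) t) v]
        refine lintegral_congr fun u => ?_
        congr 1
        ring
    _ = 2 * ∫⁻ u, ∫⁻ v, f (u + v) (u - v) := by
        congr 1
        exact lintegral_lintegral_swap (hcomp (by fun_prop) (by fun_prop)).aemeasurable

theorem lintegral_exp_mul_cosh_add_cosh_rpow {a μ ν : ℝ} (ha : |μ| + |ν| < a) :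
    ∫⁻ s : ℝ, ∫⁻ t : ℝ, ENNReal.ofReal (Real.exp (μ * s + ν * t) *
        (Real.cosh s + Real.cosh t) ^ (-a)) =
      ENNReal.ofReal (2 ^ (a - 1) / Real.Gamma a ^ 2 *
        (Real.Gamma ((a - μ - ν) / 2) * Real.Gamma ((a + μ - ν) / 2) *
          Real.Gamma ((a - μ + ν) / 2) * Real.Gamma ((a + μ + ν) / 2))) := by
  have hplus : |μ + ν| < a := (abs_add_le μ ν).trans_lt ha
  have hminus : |μ - ν| < a := (abs_sub μ ν).trans_lt ha
  have ha0 : 0 < a := (abs_nonneg _).trans_lt hplus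
  have hpoint (u v : ℝ) : Real.exp (μ * (u + v) + ν * (u - v)) *
        (Real.cosh (u + v) + Real.cosh (u - v)) ^ (-a) =
      2 ^ (-a) * (Real.exp ((μ + ν) * u) * Real.cosh u ^ (-a)) *
        (Real.exp ((μ - ν) * v) * Real.cosh v ^ (-a)) := by
    have hu := Real.cosh_pos u
    have hv := Real.cosh_pos v
    rw [Real.cosh_add, Real.cosh_sub, show Real.cosh u * Real.cosh v + Real.sinh u * Real.sinh v +
      (Real.cosh u * Real.cosh v - Real.sinh u * Real.sinh v) = 2 * Real.cosh u * Real.cosh v by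
        ring, Real.mul_rpow (by positivity) hv.le, Real.mul_rpow (by positivity) hu.le,
      show μ * (u + v) + ν * (u - v) = (μ + ν) * u + (μ - ν) * v by ring, Real.exp_add]
    ring
  have hnonneg (b u : ℝ) : 0 ≤ Real.exp (b * u) * Real.cosh u ^ (-a) := by
    have := Real.cosh_pos u
    positivity
  rw [lintegral_lintegral_eq_add_sub (by
    have := Real.continuous_cosh
    unfold Function.uncurry
    fun_prop)]
  simp_rw [hpoint]
  have hG := Real.Gamma_pos_of_pos ha0
  have htwo : (2 : ℝ) ^ (-a) = (2 ^ a)⁻¹ := Real.rpow_neg two_pos.le a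
  obtain ⟨_, _⟩ := abs_lt.mp hplus
  obtain ⟨_, _⟩ := abs_lt.mp hminus
  have h₁ : 0 < Real.Gamma ((a + (μ + ν)) / 2) := Real.Gamma_pos_of_pos (by linarith)
  have h₂ : 0 < Real.Gamma ((a - (μ + ν)) / 2) := Real.Gamma_pos_of_pos (by linarith)
  calc 2 * ∫⁻ u, ∫⁻ v, ENNReal.ofReal (2 ^ (-a) * (Real.exp ((μ + ν) * u) * Real.cosh u ^ (-a)) *
        (Real.exp ((μ - ν) * v) * Real.cosh v ^ (-a)))
      = 2 * (ENNReal.ofReal (2 ^ (-a)) *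
          (∫⁻ u, ENNReal.ofReal (Real.exp ((μ + ν) * u) * Real.cosh u ^ (-a))) *
          ∫⁻ v, ENNReal.ofReal (Real.exp ((μ - ν) * v) * Real.cosh v ^ (-a))) := by
        rw [← lintegral_const_mul' _ _ ENNReal.ofReal_ne_top, ← lintegral_mul_const' _ _ (by
          rw [lintegral_exp_mul_cosh_rpow hminus]; exact ENNReal.ofReal_ne_top)]
        congr 1
        refine lintegral_congr fun u => ?_
        rw [← ENNReal.ofReal_mul (by positivity), ← lintegral_const_mul' _ _ ENNReal.ofReal_ne_top]
        refine lintegral_congr fun v => ?_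
        rw [← ENNReal.ofReal_mul (mul_nonneg (by positivity) (hnonneg _ _))]
    _ = _ := by
        rw [lintegral_exp_mul_cosh_rpow hminus, lintegral_exp_mul_cosh_rpow hplus,
          ← ENNReal.ofReal_mul (by positivity), ← ENNReal.ofReal_mul (by positivity),
          ← ENNReal.ofReal_ofNat, ← ENNReal.ofReal_mul (by positivity)]
        congr 1
        rw [Real.rpow_sub_one two_ne_zero, htwo,
          show a + μ + ν = a + (μ + ν) by ring, show a - μ - ν = a - (μ + ν) by ring,
          show a + μ - ν = a + (μ - ν) by ring, show a - μ + ν = a - (μ - ν) by ring]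
        field_simp

theorem lintegral_rpow_mul_besselK_mul_besselK {α μ ν : ℝ} (hα : |μ| + |ν| < α) :
    ∫⁻ r in Set.Ioi (0 : ℝ), ENNReal.ofReal (r ^ (α - 1) * besselK μ r * besselK ν r) =
      ENNReal.ofReal (2 ^ (α - 3) / Real.Gamma α *
        (Real.Gamma ((α - μ - ν) / 2) * Real.Gamma ((α + μ - ν) / 2) *
          Real.Gamma ((α - μ + ν) / 2) * Real.Gamma ((α + μ + ν) / 2))) := by
  have hα0 : 0 < α := (add_nonneg (abs_nonneg _) (abs_nonneg _)).trans_lt hα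
  have hG := Real.Gamma_pos_of_pos hα0
  have hcosh := Real.continuous_cosh
  let F (r s t : ℝ) : ENNReal := ENNReal.ofReal (r ^ (α - 1) *
    Real.exp (-((Real.cosh s + Real.cosh t) * r)) * Real.exp (μ * s + ν * t))
  have hpoint (r : ℝ) (hr : r ∈ Set.Ioi (0 : ℝ)) :
      ENNReal.ofReal (r ^ (α - 1) * besselK μ r * besselK ν r) =
        ENNReal.ofReal (1 / 4) * ∫⁻ s, ∫⁻ t, F r s t := by
    have hr : 0 < r := hr
    have hfin (μ : ℝ) : ∫⁻ t : ℝ, ENNReal.ofReal (Real.exp (μ * t - r * Real.cosh t)) ≠ ⊤ := by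
      rw [← ofReal_integral_eq_lintegral_ofReal (integrable_exp_sub_mul_cosh μ hr)
        (ae_of_all _ fun t => (Real.exp_pos _).le)]
      exact ENNReal.ofReal_ne_top
    have hprod : ∫⁻ s, ∫⁻ t, F r s t = ENNReal.ofReal (r ^ (α - 1)) *
        (∫⁻ t : ℝ, ENNReal.ofReal (Real.exp (μ * t - r * Real.cosh t))) *
        ∫⁻ t : ℝ, ENNReal.ofReal (Real.exp (ν * t - r * Real.cosh t)) := by
      rw [← lintegral_const_mul' _ _ ENNReal.ofReal_ne_top, ← lintegral_mul_const' _ _ (hfin ν)]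
      refine lintegral_congr fun s => ?_
      rw [← ENNReal.ofReal_mul (by positivity), ← lintegral_const_mul' _ _ ENNReal.ofReal_ne_top]
      refine lintegral_congr fun t => ?_
      rw [← ENNReal.ofReal_mul (by positivity)]
      simp only [F]
      rw [mul_assoc, mul_assoc, ← Real.exp_add, ← Real.exp_add]
      congr 3
      ring
    rw [ENNReal.ofReal_mul (mul_nonneg (by positivity) (besselK_nonneg _ _)),
      ENNReal.ofReal_mul (by positivity), ofReal_besselK μ hr, ofReal_besselK ν hr, hprod,
      show (1 / 4 : ℝ) = 1 / 2 * (1 / 2) by norm_num, ENNReal.ofReal_mul (by norm_num)]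
    ring
  have hF : Measurable fun z : ℝ × ℝ × ℝ => F z.1 z.2.1 z.2.2 := by
    simp only [F]
    fun_prop
  have hcomp {β : Type} [MeasurableSpace β] {x y z : β → ℝ} (hx : Measurable x)
      (hy : Measurable y) (hz : Measurable z) : Measurable fun w => F (x w) (y w) (z w) :=
    hF.comp (hx.prodMk (hy.prodMk hz))
  have hinner (s t : ℝ) : ∫⁻ r in Set.Ioi (0 : ℝ), F r s t = ENNReal.ofReal (Real.Gamma α) *
      ENNReal.ofReal (Real.exp (μ * s + ν * t) * (Real.cosh s + Real.cosh t) ^ (-α)) := by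
    have hc : 0 < Real.cosh s + Real.cosh t := add_pos (Real.cosh_pos s) (Real.cosh_pos t)
    calc ∫⁻ r in Set.Ioi (0 : ℝ), F r s t
        = (∫⁻ r in Set.Ioi (0 : ℝ), ENNReal.ofReal (r ^ (α - 1) *
          Real.exp (-((Real.cosh s + Real.cosh t) * r)))) *
          ENNReal.ofReal (Real.exp (μ * s + ν * t)) := by
          rw [← lintegral_mul_const' _ _ ENNReal.ofReal_ne_top]
          refine lintegral_congr fun r => ?_
          rw [← ENNReal.ofReal_mul' (Real.exp_pos _).le]
      _ = _ := by
          rw [lintegral_rpow_mul_exp_neg_mul_Ioi hα0 hc, ← ENNReal.ofReal_mul (by positivity),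
            ← ENNReal.ofReal_mul hG.le]
          congr 1
          ring
  calc ∫⁻ r in Set.Ioi (0 : ℝ), ENNReal.ofReal (r ^ (α - 1) * besselK μ r * besselK ν r)
      = ENNReal.ofReal (1 / 4) * ∫⁻ r in Set.Ioi (0 : ℝ), ∫⁻ s, ∫⁻ t, F r s t := by
        rw [setLIntegral_congr_fun measurableSet_Ioi hpoint,
          lintegral_const_mul' _ _ ENNReal.ofReal_ne_top]
    _ = ENNReal.ofReal (1 / 4) * ∫⁻ s, ∫⁻ t, ∫⁻ r in Set.Ioi (0 : ℝ), F r s t := by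
        have hrs : Measurable fun w : ℝ × ℝ => ∫⁻ t, F w.1 w.2 t :=
          (hcomp (x := fun z : (ℝ × ℝ) × ℝ => z.1.1) (y := fun z => z.1.2) (z := fun z => z.2)
            (by fun_prop) (by fun_prop) (by fun_prop)).lintegral_prod_right'
        rw [lintegral_lintegral_swap hrs.aemeasurable]
        congr 1
        refine lintegral_congr fun s => ?_
        exact lintegral_lintegral_swap
          (hcomp (by fun_prop) (by fun_prop) (by fun_prop)).aemeasurable
    _ = ENNReal.ofReal (1 / 4) * (ENNReal.ofReal (Real.Gamma α) *
          ∫⁻ s : ℝ, ∫⁻ t : ℝ, ENNReal.ofReal (Real.exp (μ * s + ν * t) *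
            (Real.cosh s + Real.cosh t) ^ (-α))) := by
        simp_rw [hinner, lintegral_const_mul' _ _ (ENNReal.ofReal_ne_top (r := Real.Gamma α))]
    _ = _ := by
        rw [lintegral_exp_mul_cosh_add_cosh_rpow hα, ← ENNReal.ofReal_mul hG.le,
          ← ENNReal.ofReal_mul (by norm_num)]
        congr 1
        rw [show α - 3 = α - 1 - 2 by ring, Real.rpow_sub two_pos (α - 1)]
        field_simp
        ring

/-- for `α > |μ| + |ν|`,
`∫_0^∞ r^{α−1} K_μ(r) K_ν(r) dr
  = (2^{α−3}/Γ(α)) Γ((α−μ−ν)/2) Γ((α+μ−ν)/2) Γ((α−μ+ν)/2) Γ((α+μ+ν)/2)`. -/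
theorem stmt11 (α μ ν : ℝ) (hα : |μ| + |ν| < α) :
    IntegrableOn (fun r : ℝ => r ^ (α - 1) * besselK μ r * besselK ν r) (Set.Ioi 0) ∧
    (∫ r in Set.Ioi (0:ℝ), r ^ (α - 1) * besselK μ r * besselK ν r)
      = 2 ^ (α - 3) / Real.Gamma α *
        (Real.Gamma ((α - μ - ν) / 2) * Real.Gamma ((α + μ - ν) / 2) *
          Real.Gamma ((α - μ + ν) / 2) * Real.Gamma ((α + μ + ν) / 2)) := by
  have hlint := lintegral_rpow_mul_besselK_mul_besselK hα
  have hmeas : AEStronglyMeasurable (fun r : ℝ => r ^ (α - 1) * besselK μ r * besselK ν r)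
      (volume.restrict (Set.Ioi 0)) := by
    have := measurable_besselK μ
    have := measurable_besselK ν
    exact Measurable.aestronglyMeasurable (by fun_prop)
  have hnonneg : 0 ≤ᵐ[volume.restrict (Set.Ioi 0)]
      fun r : ℝ => r ^ (α - 1) * besselK μ r * besselK ν r :=
    (ae_restrict_mem measurableSet_Ioi).mono fun r hr =>
      mul_nonneg (mul_nonneg (Real.rpow_nonneg (le_of_lt hr) _) (besselK_nonneg _ _))
        (besselK_nonneg _ _)
  refine ⟨⟨hmeas, ?_⟩, ?_⟩
  · rw [hasFiniteIntegral_iff_ofReal hnonneg, hlint]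
    exact ENNReal.ofReal_lt_top
  · have hα0 : 0 ≤ α := (add_nonneg (abs_nonneg _) (abs_nonneg _)).trans hα.le
    have hΓ {x : ℝ} (hx : 0 ≤ x) : 0 ≤ Real.Gamma x := Real.Gamma_nonneg_of_nonneg hx
    have := le_abs_self μ
    have := neg_abs_le μ
    have := le_abs_self ν
    have := neg_abs_le ν
    have h₁ := hΓ (x := (α - μ - ν) / 2) (by linarith)
    have h₂ := hΓ (x := (α + μ - ν) / 2) (by linarith)
    have h₃ := hΓ (x := (α - μ + ν) / 2) (by linarith)
    have h₄ := hΓ (x := (α + μ + ν) / 2) (by linarith)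
    have h₅ := hΓ hα0
    rw [integral_eq_lintegral_of_nonneg_ae hnonneg hmeas, hlint,
      ENNReal.toReal_ofReal (by positivity)]
end
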